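/- arXiv:2604.24423 — 4 statements merged into one kernel-verified Lean document; each statement's English description precedes it below -/
import Mathlib

section
/- When m = 2, the support function of the separable correlation set satisfies, for every real 2×2 matrix Z, φ_{C_sep}(Z) = sqrt( ( Tr[G_α Z G_β Zᵀ] + |Tr[G_α Z H_β Zᵀ]| ) / 2 ), where |·| denotes the complex modulus. -/
open Matrix Kronecker
open scoped ENNReal ComplexOrder

namespace BellCorr

/-- The three Pauli matrices. -/
noncomputable def pauli (k : Fin 3) : Matrix (Fin 2) (Fin 2) ℂ :=
  if k = 0 then !![0, 1; 1, 0]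
  else if k = 1 then !![0, -Complex.I; Complex.I, 0]
  else !![1, 0; 0, -1]

/-- The observable `Â_i = ∑ k A i k • σ_k` associated with row `i` of `A`. -/
noncomputable def obs {m : ℕ} (A : Matrix (Fin m) (Fin 3) ℝ) (i : Fin m) :
    Matrix (Fin 2) (Fin 2) ℂ :=
  ∑ k : Fin 3, (A i k : ℂ) • pauli k

/-- The correlation map `Φ_AB`, sending a 4×4 complex matrix to the real m×m matrix
with entries `Tr[ρ (Â_i ⊗ B̂_j)]`. -/
noncomputable def corr {m : ℕ} (A B : Matrix (Fin m) (Fin 3) ℝ)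
    (ρ : Matrix (Fin 2 × Fin 2) (Fin 2 × Fin 2) ℂ) : Matrix (Fin m) (Fin m) ℝ :=
  Matrix.of fun i j => ((ρ * (obs A i ⊗ₖ obs B j)).trace).re

/-- Separable states: convex hull of products of 2×2 PSD trace-one matrices. -/
noncomputable def Ssep : Set (Matrix (Fin 2 × Fin 2) (Fin 2 × Fin 2) ℂ) :=
  convexHull ℝ {ρ | ∃ ρA ρB : Matrix (Fin 2) (Fin 2) ℂ,
    ρA.PosSemidef ∧ ρA.trace = 1 ∧ ρB.PosSemidef ∧ ρB.trace = 1 ∧ ρ = ρA ⊗ₖ ρB}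

/-- Quantum states: 4×4 PSD matrices of trace one. -/
def Sqm : Set (Matrix (Fin 2 × Fin 2) (Fin 2 × Fin 2) ℂ) :=
  {ρ | ρ.PosSemidef ∧ ρ.trace = 1}

/-- Maximal-tensor-product states: self-adjoint trace-one matrices pairing
nonnegatively with every product of PSD matrices. -/
def Smax : Set (Matrix (Fin 2 × Fin 2) (Fin 2 × Fin 2) ℂ) :=
  {ρ | ρ.IsHermitian ∧ ρ.trace = 1 ∧
    ∀ P Q : Matrix (Fin 2) (Fin 2) ℂ, P.PosSemidef → Q.PosSemidef →
      0 ≤ ((ρ * (P ⊗ₖ Q)).trace).re}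

noncomputable def Csep {m : ℕ} (A B : Matrix (Fin m) (Fin 3) ℝ) :
    Set (Matrix (Fin m) (Fin m) ℝ) := corr A B '' Ssep

noncomputable def Cqm {m : ℕ} (A B : Matrix (Fin m) (Fin 3) ℝ) :
    Set (Matrix (Fin m) (Fin m) ℝ) := corr A B '' Sqm

noncomputable def Cmax {m : ℕ} (A B : Matrix (Fin m) (Fin 3) ℝ) :
    Set (Matrix (Fin m) (Fin m) ℝ) := corr A B '' Smax

/-- Support function `φ_K(Z) = sup_{C ∈ K} Tr[Zᵀ C]`. -/
noncomputable def suppFn {m : ℕ} (K : Set (Matrix (Fin m) (Fin m) ℝ))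
    (Z : Matrix (Fin m) (Fin m) ℝ) : ℝ :=
  sSup ((fun C => (Zᵀ * C).trace) '' K)

/-- Gauge function `γ_K(C) = inf {t > 0 : C/t ∈ K}`, with value `+∞` if no such `t` exists. -/
noncomputable def gaugeFn {m : ℕ} (K : Set (Matrix (Fin m) (Fin m) ℝ))
    (C : Matrix (Fin m) (Fin m) ℝ) : ℝ≥0∞ :=
  ⨅ (t : ℝ) (_ : 0 < t ∧ t⁻¹ • C ∈ K), ENNReal.ofReal t

/-- `XᵀX` is Hermitian for a real matrix `X`. -/
lemma isHermitian_tr_mul_self (X : Matrix (Fin 3) (Fin 3) ℝ) : (Xᵀ * X).IsHermitian := by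
  simpa [Matrix.conjTranspose_eq_transpose_of_trivial] using
    Matrix.isHermitian_conjTranspose_mul_self X

/-- The singular values of a real 3×3 matrix, in decreasing order:
`sval X 0 ≥ sval X 1 ≥ sval X 2 ≥ 0` are the square roots of the eigenvalues of `XᵀX`. -/
noncomputable def sval (X : Matrix (Fin 3) (Fin 3) ℝ) (i : Fin 3) : ℝ :=
  Real.sqrt ((isHermitian_tr_mul_self X).eigenvalues
    (Tuple.sort (isHermitian_tr_mul_self X).eigenvalues i.rev))

/-- Column space of a real matrix. -/
noncomputable def colSpace {m n : ℕ} (X : Matrix (Fin m) (Fin n) ℝ) :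
    Submodule ℝ (Fin m → ℝ) := LinearMap.range X.mulVecLin

/-- `Y` is the Moore–Penrose pseudoinverse of `X`. -/
def IsMP {m n : ℕ} (X : Matrix (Fin m) (Fin n) ℝ) (Y : Matrix (Fin n) (Fin m) ℝ) : Prop :=
  X * Y * X = X ∧ Y * X * Y = Y ∧ (X * Y)ᵀ = X * Y ∧ (Y * X)ᵀ = Y * X

/-- `G_θ = [[1, cos θ],[cos θ, 1]]`. -/
noncomputable def Gmat (θ : ℝ) : Matrix (Fin 2) (Fin 2) ℝ :=
  !![1, Real.cos θ; Real.cos θ, 1]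

/-- `H_θ = [[e^{−iθ}, 1],[1, e^{iθ}]]`. -/
noncomputable def Hmat (θ : ℝ) : Matrix (Fin 2) (Fin 2) ℂ :=
  !![Complex.exp (-(θ : ℂ) * Complex.I), 1; 1, Complex.exp ((θ : ℂ) * Complex.I)]

lemma quadForm_le {P Q R N x y : ℝ} (hN : 0 ≤ N) (h : N ^ 2 = (P - R) ^ 2 + (2 * Q) ^ 2)
    (hK : 0 ≤ P + R + N) (hxy : x ^ 2 + y ^ 2 ≤ 1) :
    P * x ^ 2 + 2 * Q * (x * y) + R * y ^ 2 ≤ (P + R + N) / 2 := by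
  have h1 : (P - R) * (x ^ 2 - y ^ 2) + 2 * Q * (2 * (x * y)) ≤ N * (x ^ 2 + y ^ 2) := by
    apply le_of_sq_le_sq _ (by positivity)
    rw [mul_pow, h]
    linarith [sq_nonneg ((P - R) * (2 * (x * y)) - 2 * Q * (x ^ 2 - y ^ 2))]
  linarith [mul_le_mul_of_nonneg_left hxy hK]

lemma exists_quadForm_eq {P Q R N : ℝ} (hN : 0 ≤ N) (h : N ^ 2 = (P - R) ^ 2 + (2 * Q) ^ 2) :
    ∃ x y : ℝ, x ^ 2 + y ^ 2 = 1 ∧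
      P * x ^ 2 + 2 * Q * (x * y) + R * y ^ 2 = (P + R + N) / 2 := by
  set z : ℂ := ⟨P - R, 2 * Q⟩ with hz
  have hzN : ‖z‖ = N := by
    rw [← sq_eq_sq₀ (norm_nonneg _) hN, h, ← Complex.normSq_eq_norm_sq, Complex.normSq_apply]
    simp only [hz]
    ring
  have hre : N * Real.cos z.arg = P - R := hzN ▸ Complex.norm_mul_cos_arg z
  have him : N * Real.sin z.arg = 2 * Q := hzN ▸ Complex.norm_mul_sin_arg z
  obtain ⟨t, ht⟩ : ∃ t, z.arg = 2 * t := ⟨z.arg / 2, by ring⟩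
  rw [ht, Real.cos_two_mul] at hre
  rw [ht, Real.sin_two_mul] at him
  have hcs := Real.sin_sq_add_cos_sq t
  refine ⟨Real.cos t, Real.sin t, by linarith, ?_⟩
  have hP : P = R + N * (2 * Real.cos t ^ 2 - 1) := by linarith
  rw [← him, hP]
  linear_combination (R + 2 * N * Real.cos t ^ 2) * hcs

lemma exists_unit_orthogonal (a : Fin 3 → ℝ) : ∃ e : Fin 3 → ℝ, e ⬝ᵥ e = 1 ∧ a ⬝ᵥ e = 0 := by
  by_cases h : a 0 ^ 2 + a 1 ^ 2 = 0
  · have h0 : a 0 = 0 := by nlinarith [sq_nonneg (a 0), sq_nonneg (a 1)]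
    exact ⟨![1, 0, 0], by simp [dotProduct, Fin.sum_univ_three],
      by simp [dotProduct, Fin.sum_univ_three, h0]⟩
  · have hs : √(a 0 ^ 2 + a 1 ^ 2) ^ 2 = a 0 ^ 2 + a 1 ^ 2 := Real.sq_sqrt (by positivity)
    have hne : √(a 0 ^ 2 + a 1 ^ 2) ≠ 0 := fun h0 => h (by rw [← hs, h0]; ring)
    refine ⟨![-a 1 / √(a 0 ^ 2 + a 1 ^ 2), a 0 / √(a 0 ^ 2 + a 1 ^ 2), 0], ?_, ?_⟩
    · simp [dotProduct, Fin.sum_univ_three]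
      field_simp
      linarith
    · simp [dotProduct, Fin.sum_univ_three]
      field_simp
      ring

lemma dotProduct_sq_le (a b : Fin 3 → ℝ) : (a ⬝ᵥ b) ^ 2 ≤ (a ⬝ᵥ a) * (b ⬝ᵥ b) := by
  simpa [dotProduct, sq] using Finset.sum_mul_sq_le_sq_mul_sq Finset.univ a b

lemma exists_orthonormal_decomp {a b : Fin 3 → ℝ} {s : ℝ} (ha : a ⬝ᵥ a = 1) (hb : b ⬝ᵥ b = 1)
    (hs : s ^ 2 = 1 - (a ⬝ᵥ b) ^ 2) :
    ∃ e : Fin 3 → ℝ, e ⬝ᵥ e = 1 ∧ a ⬝ᵥ e = 0 ∧ b = (a ⬝ᵥ b) • a + s • e := by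
  have key : (b - (a ⬝ᵥ b) • a) ⬝ᵥ (b - (a ⬝ᵥ b) • a) = s ^ 2 := by
    simp only [sub_dotProduct, dotProduct_sub, smul_dotProduct, dotProduct_smul, ha, hb,
      dotProduct_comm b a, hs, smul_eq_mul]
    ring
  by_cases h : s = 0
  · obtain ⟨e, he, hae⟩ := exists_unit_orthogonal a
    refine ⟨e, he, hae, ?_⟩
    rw [h, zero_pow two_ne_zero, dotProduct_self_eq_zero] at key
    rw [h, zero_smul, add_zero, ← sub_eq_zero, key]
  · refine ⟨s⁻¹ • (b - (a ⬝ᵥ b) • a), ?_, ?_, ?_⟩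
    · rw [smul_dotProduct, dotProduct_smul, key, smul_eq_mul, smul_eq_mul]
      field_simp
    · simp [dotProduct_sub, ha]
    · rw [smul_inv_smul₀ h]
      abel

lemma dotProduct_sq_add_sq_le {a e : Fin 3 → ℝ} (ha : a ⬝ᵥ a = 1) (he : e ⬝ᵥ e = 1)
    (hae : a ⬝ᵥ e = 0) (y : Fin 3 → ℝ) : (a ⬝ᵥ y) ^ 2 + (e ⬝ᵥ y) ^ 2 ≤ y ⬝ᵥ y := by
  have h : 0 ≤ (y - (a ⬝ᵥ y) • a - (e ⬝ᵥ y) • e) ⬝ᵥ (y - (a ⬝ᵥ y) • a - (e ⬝ᵥ y) • e) :=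
    Finset.sum_nonneg fun i _ => mul_self_nonneg _
  simp only [sub_dotProduct, dotProduct_sub, smul_dotProduct, dotProduct_smul, ha, he, hae,
    dotProduct_comm e a, dotProduct_comm y a, dotProduct_comm y e, smul_eq_mul] at h
  linarith

/-- The squared Euclidean norm of `Aᵀ Z u`, when the rows of `A` are unit vectors with inner
product `c`. -/
def gramForm (c : ℝ) (Z : Matrix (Fin 2) (Fin 2) ℝ) (u₀ u₁ : ℝ) : ℝ :=
  (Z 0 0 * u₀ + Z 0 1 * u₁) ^ 2 + (Z 1 0 * u₀ + Z 1 1 * u₁) ^ 2 +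
    2 * c * ((Z 0 0 * u₀ + Z 0 1 * u₁) * (Z 1 0 * u₀ + Z 1 1 * u₁))

lemma dotProduct_self_eq_gramForm {A : Matrix (Fin 2) (Fin 3) ℝ} (hA : ∀ i, A i ⬝ᵥ A i = 1)
    (Z : Matrix (Fin 2) (Fin 2) ℝ) (u : Fin 2 → ℝ) :
    (Aᵀ *ᵥ (Z *ᵥ u)) ⬝ᵥ (Aᵀ *ᵥ (Z *ᵥ u)) = gramForm (A 0 ⬝ᵥ A 1) Z (u 0) (u 1) := by
  have h0 := hA 0
  have h1 := hA 1
  simp only [dotProduct, Fin.sum_univ_three] at h0 h1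
  simp only [gramForm, dotProduct, mulVec, transpose_apply, Fin.sum_univ_three, Fin.sum_univ_two]
  linear_combination (Z 0 0 * u 0 + Z 0 1 * u 1) ^ 2 * h0 + (Z 1 0 * u 0 + Z 1 1 * u 1) ^ 2 * h1

/-- The maximum of `gramForm c Z` over the vectors `(cos t, cos (t - β))`. -/
noncomputable def gramMax (c β : ℝ) (Z : Matrix (Fin 2) (Fin 2) ℝ) : ℝ :=
  ((!![1, c; c, 1] * Z * Gmat β * Zᵀ).trace +
    ‖((!![1, c; c, 1] : Matrix (Fin 2) (Fin 2) ℝ).map Complex.ofReal * Z.map Complex.ofReal *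
      Hmat β * (Zᵀ).map Complex.ofReal).trace‖) / 2

lemma exists_gramForm_coeffs (c β : ℝ) (Z : Matrix (Fin 2) (Fin 2) ℝ) :
    ∃ P Q R N : ℝ, 0 ≤ N ∧ N ^ 2 = (P - R) ^ 2 + (2 * Q) ^ 2 ∧ gramMax c β Z = (P + R + N) / 2 ∧
      ∀ x y, gramForm c Z x (Real.cos β * x + Real.sin β * y) =
        P * x ^ 2 + 2 * Q * (x * y) + R * y ^ 2 := by
  set S₀ := Z 0 0 ^ 2 + Z 1 0 ^ 2 + 2 * c * (Z 0 0 * Z 1 0) with hS₀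
  set S₁ := Z 0 0 * Z 0 1 + Z 1 0 * Z 1 1 + c * (Z 0 0 * Z 1 1 + Z 0 1 * Z 1 0) with hS₁
  set S₂ := Z 0 1 ^ 2 + Z 1 1 ^ 2 + 2 * c * (Z 0 1 * Z 1 1) with hS₂
  have hcs := Real.sin_sq_add_cos_sq β
  refine ⟨S₀ + 2 * Real.cos β * S₁ + Real.cos β ^ 2 * S₂,
    Real.sin β * (S₁ + Real.cos β * S₂), Real.sin β ^ 2 * S₂, _, norm_nonneg _, ?_,
    congrArg (fun t : ℝ => (t + _) / 2) ?_, fun x y => ?_⟩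
  · rw [← Complex.normSq_eq_norm_sq]
    have hH : Hmat β = !![(Real.cos β : ℂ) - Real.sin β * Complex.I, 1;
        1, (Real.cos β : ℂ) + Real.sin β * Complex.I] := by
      rw [Hmat, Complex.exp_mul_I, Complex.exp_mul_I]
      simp [sub_eq_add_neg]
    have hz : ((!![1, c; c, 1] : Matrix (Fin 2) (Fin 2) ℝ).map Complex.ofReal *
        Z.map Complex.ofReal * Hmat β * (Zᵀ).map Complex.ofReal).trace =
        ⟨(S₀ + S₂) * Real.cos β + 2 * S₁, (S₂ - S₀) * Real.sin β⟩ := by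
      rw [hH, Complex.mk_eq_add_mul_I]
      simp only [trace_fin_two, mul_apply, Fin.sum_univ_two, map_apply, transpose_apply,
        of_apply, cons_val_zero, cons_val_one, hS₀, hS₁, hS₂]
      simp
      ring
    rw [hz, Complex.normSq_mk]
    linear_combination (-4 * S₁ ^ 2 - 4 * Real.cos β * S₁ * S₂ - S₂ ^ 2 * (Real.cos β ^ 2 + Real.sin β ^ 2) + S₀ ^ 2) *
      hcs
  · simp only [Gmat, trace_fin_two, mul_apply, Fin.sum_univ_two, transpose_apply,
        of_apply, cons_val_zero, cons_val_one, hS₀, hS₁, hS₂, cons_val', cons_val_fin_one]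
    linear_combination (-S₂) * hcs
  · simp only [gramForm, hS₀, hS₁, hS₂]
    ring

lemma mulVec_one_eq {B : Matrix (Fin 2) (Fin 3) ℝ} {e : Fin 3 → ℝ} {c s : ℝ}
    (h : B 1 = c • B 0 + s • e) (y : Fin 3 → ℝ) :
    (B *ᵥ y) 1 = c * (B 0 ⬝ᵥ y) + s * (e ⬝ᵥ y) := by
  change B 1 ⬝ᵥ y = _
  rw [h, add_dotProduct, smul_dotProduct, smul_dotProduct, smul_eq_mul, smul_eq_mul]

/-- The largest value of `(A x) ⬝ Z (B y)` over unit vectors `x`, `y` bounds its values on the unit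
balls. -/
lemma bilin_max {A B : Matrix (Fin 2) (Fin 3) ℝ}
    (hA : ∀ i, A i ⬝ᵥ A i = 1) (hB : ∀ i, B i ⬝ᵥ B i = 1) (Z : Matrix (Fin 2) (Fin 2) ℝ) :
    (∀ x y : Fin 3 → ℝ, x ⬝ᵥ x ≤ 1 → y ⬝ᵥ y ≤ 1 → (A *ᵥ x) ⬝ᵥ (Z *ᵥ (B *ᵥ y)) ≤
      √(gramMax (A 0 ⬝ᵥ A 1) (Real.arccos (B 0 ⬝ᵥ B 1)) Z)) ∧
    ∃ x y : Fin 3 → ℝ, x ⬝ᵥ x = 1 ∧ y ⬝ᵥ y = 1 ∧ (A *ᵥ x) ⬝ᵥ (Z *ᵥ (B *ᵥ y)) =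
      √(gramMax (A 0 ⬝ᵥ A 1) (Real.arccos (B 0 ⬝ᵥ B 1)) Z) := by
  have hc : (B 0 ⬝ᵥ B 1) ^ 2 ≤ 1 := by simpa [hB] using dotProduct_sq_le (B 0) (B 1)
  obtain ⟨hc₁, hc₂⟩ := abs_le.1 ((sq_le_one_iff_abs_le_one _).1 hc)
  have hcos := Real.cos_arccos hc₁ hc₂
  set β := Real.arccos (B 0 ⬝ᵥ B 1)
  obtain ⟨e, he, hae, hdec⟩ := exists_orthonormal_decomp (s := Real.sin β) (hB 0) (hB 1)
    (by rw [Real.sin_sq, hcos])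
  rw [← hcos] at hdec
  obtain ⟨P, Q, R, N, hN, hN2, hmax, hform⟩ := exists_gramForm_coeffs (A 0 ⬝ᵥ A 1) β Z
  have hadj (x : Fin 3 → ℝ) (u : Fin 2 → ℝ) : (A *ᵥ x) ⬝ᵥ u = x ⬝ᵥ (Aᵀ *ᵥ u) := by
    rw [dotProduct_comm, dotProduct_mulVec, ← mulVec_transpose, dotProduct_comm]
  have hnorm (y : Fin 3 → ℝ) : (Aᵀ *ᵥ (Z *ᵥ (B *ᵥ y))) ⬝ᵥ (Aᵀ *ᵥ (Z *ᵥ (B *ᵥ y))) =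
      P * (B 0 ⬝ᵥ y) ^ 2 + 2 * Q * ((B 0 ⬝ᵥ y) * (e ⬝ᵥ y)) + R * (e ⬝ᵥ y) ^ 2 := by
    rw [dotProduct_self_eq_gramForm hA, mulVec_one_eq hdec, ← hform]
    rfl
  have hself (v : Fin 3 → ℝ) : 0 ≤ v ⬝ᵥ v := Finset.sum_nonneg fun i _ => mul_self_nonneg _
  obtain ⟨p, r, hpr, hval⟩ := exists_quadForm_eq hN hN2
  set y : Fin 3 → ℝ := p • B 0 + r • e with hy
  have h0 : B 0 ⬝ᵥ y = p := by simp [hy, hB, hae]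
  have h1 : e ⬝ᵥ y = r := by simp [hy, dotProduct_comm e (B 0), hae, he]
  have hatt : (Aᵀ *ᵥ (Z *ᵥ (B *ᵥ y))) ⬝ᵥ (Aᵀ *ᵥ (Z *ᵥ (B *ᵥ y))) = (P + R + N) / 2 := by
    rw [hnorm, h0, h1, hval]
  have hK : 0 ≤ (P + R + N) / 2 := hatt ▸ hself _
  rw [hmax]
  constructor
  · intro x y hx hy
    rw [hadj]
    refine Real.le_sqrt_of_sq_le ((dotProduct_sq_le _ _).trans ?_)
    refine (mul_le_of_le_one_left (hself _) hx).trans ?_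
    rw [hnorm]
    exact quadForm_le hN hN2 (by linarith) ((dotProduct_sq_add_sq_le (hB 0) he hae y).trans hy)
  · have hyy : y ⬝ᵥ y = 1 := by
      have : y ⬝ᵥ y = p * (B 0 ⬝ᵥ y) + r * (e ⬝ᵥ y) := by
        nth_rewrite 1 [hy]
        simp
      rw [this, h0, h1, ← hpr]
      ring
    set v := Aᵀ *ᵥ (Z *ᵥ (B *ᵥ y))
    by_cases hv : (P + R + N) / 2 = 0
    · rw [hv, dotProduct_self_eq_zero] at hatt
      exact ⟨y, y, hyy, hyy, by
        rw [hadj, hv, Real.sqrt_zero]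
        exact (congrArg _ hatt).trans (dotProduct_zero y)⟩
    · have hs : √((P + R + N) / 2) ≠ 0 := fun h => hv ((Real.sqrt_eq_zero hK).1 h)
      refine ⟨(√((P + R + N) / 2))⁻¹ • v, y, ?_, hyy, ?_⟩
      · rw [smul_dotProduct, dotProduct_smul, hatt, smul_eq_mul, smul_eq_mul]
        nth_rewrite 3 [← Real.mul_self_sqrt hK]
        field_simp
      · rw [hadj, smul_dotProduct, hatt, smul_eq_mul]
        nth_rewrite 2 [← Real.mul_self_sqrt hK]
        field_simp

/-- The Bloch vector of a 2×2 matrix. -/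
noncomputable def blochVec (ρ : Matrix (Fin 2) (Fin 2) ℂ) : Fin 3 → ℝ :=
  fun k => (ρ * pauli k).trace.re

lemma trace_mul_obs {ρ : Matrix (Fin 2) (Fin 2) ℂ} (hρ : ρ.IsHermitian)
    (A : Matrix (Fin 2) (Fin 3) ℝ) (i : Fin 2) :
    (ρ * obs A i).trace = ((A *ᵥ blochVec ρ) i : ℝ) := by
  have h (k : Fin 3) : (ρ * pauli k).trace = (blochVec ρ k : ℝ) := by
    have h00 := congrArg Complex.im (hρ.apply 0 0)
    have h11 := congrArg Complex.im (hρ.apply 1 1)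
    have h01 := hρ.apply 0 1
    have h01r := congrArg Complex.re h01
    have h01i := congrArg Complex.im h01
    simp at h00 h11 h01r h01i
    apply Complex.ext
    · simp [blochVec]
    · fin_cases k <;> simp [pauli, trace_fin_two, mul_apply, Fin.sum_univ_two] <;> linarith
  simp only [obs, Matrix.mul_sum, Matrix.mul_smul, trace_sum, trace_smul, h, mulVec, dotProduct]
  push_cast
  rfl

lemma blochVec_dotProduct_self_le {ρ : Matrix (Fin 2) (Fin 2) ℂ} (hρ : ρ.PosSemidef)
    (ht : ρ.trace = 1) : blochVec ρ ⬝ᵥ blochVec ρ ≤ 1 := by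
  have hd := (Complex.le_def.1 hρ.det_nonneg).1
  have h00 := congrArg Complex.im (hρ.isHermitian.apply 0 0)
  have h11 := congrArg Complex.im (hρ.isHermitian.apply 1 1)
  have h01r := congrArg Complex.re (hρ.isHermitian.apply 0 1)
  have h01i := congrArg Complex.im (hρ.isHermitian.apply 0 1)
  have htr := congrArg Complex.re ht
  simp [det_fin_two, trace_fin_two] at hd h00 h11 h01r h01i htr
  simp [blochVec, dotProduct, Fin.sum_univ_three, pauli, trace_fin_two, mul_apply,
    Fin.sum_univ_two]
  have e0 : (ρ 0 0).im = 0 := by linarith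
  have e1 : (ρ 1 1).im = 0 := by linarith
  have e2 : (ρ 1 1).re = 1 - (ρ 0 0).re := by linarith
  rw [e0, e2, ← h01r, ← h01i] at hd
  rw [e2, ← h01r, ← h01i]
  nlinarith

lemma exists_state_blochVec_eq {x : Fin 3 → ℝ} (hx : x ⬝ᵥ x = 1) :
    ∃ ρ : Matrix (Fin 2) (Fin 2) ℂ, ρ.PosSemidef ∧ ρ.trace = 1 ∧ blochVec ρ = x := by
  set ρ : Matrix (Fin 2) (Fin 2) ℂ :=
    !![(1 + x 2) / 2, (x 0 - x 1 * Complex.I) / 2; (x 0 + x 1 * Complex.I) / 2, (1 - x 2) / 2]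
    with hρ
  have hx' : (x 0 : ℂ) * x 0 + x 1 * x 1 + x 2 * x 2 = 1 := by
    simp only [dotProduct, Fin.sum_univ_three] at hx
    exact_mod_cast hx
  have hproj : ρ = ρᴴ * ρ := by
    ext i j
    fin_cases i <;> fin_cases j <;>
      simp [hρ, mul_apply, Fin.sum_univ_two, conjTranspose_apply, Complex.conj_ofNat]
    · linear_combination (-1 / 4 : ℂ) * hx' + (x 1 : ℂ) ^ 2 / 4 * Complex.I_sq
    · ring
    · ring
    · linear_combination (-1 / 4 : ℂ) * hx' + (x 1 : ℂ) ^ 2 / 4 * Complex.I_sq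
  refine ⟨ρ, hproj ▸ posSemidef_conjTranspose_mul_self ρ, ?_, ?_⟩
  · simp [hρ, trace_fin_two]
    ring
  · funext k
    fin_cases k <;> simp [hρ, blochVec, pauli, trace_fin_two] <;> ring

lemma trace_transpose_mul_corr_kronecker {ρA ρB : Matrix (Fin 2) (Fin 2) ℂ}
    (hA : ρA.IsHermitian) (hB : ρB.IsHermitian) (A B : Matrix (Fin 2) (Fin 3) ℝ)
    (Z : Matrix (Fin 2) (Fin 2) ℝ) :
    (Zᵀ * corr A B (ρA ⊗ₖ ρB)).trace = (A *ᵥ blochVec ρA) ⬝ᵥ (Z *ᵥ (B *ᵥ blochVec ρB)) := by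
  have h (i j : Fin 2) : corr A B (ρA ⊗ₖ ρB) i j =
      (A *ᵥ blochVec ρA) i * (B *ᵥ blochVec ρB) j := by
    rw [corr, of_apply, ← mul_kronecker_mul, trace_kronecker, trace_mul_obs hA, trace_mul_obs hB,
      ← Complex.ofReal_mul, Complex.ofReal_re]
  simp only [trace_fin_two, mul_apply, Fin.sum_univ_two, transpose_apply, h]
  generalize A *ᵥ blochVec ρA = u
  generalize B *ᵥ blochVec ρB = v
  simp only [dotProduct, mulVec, Fin.sum_univ_two]
  ring

lemma isLinearMap_trace_transpose_mul_corr (A B : Matrix (Fin 2) (Fin 3) ℝ)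
    (Z : Matrix (Fin 2) (Fin 2) ℝ) :
    IsLinearMap ℝ fun ρ => (Zᵀ * corr A B ρ).trace := by
  have hadd (ρ τ) : corr A B (ρ + τ) = corr A B ρ + corr A B τ := by
    ext i j
    simp [corr, Matrix.add_mul]
  have hsmul (t : ℝ) (ρ) : corr A B (t • ρ) = t • corr A B ρ := by
    ext i j
    simp [corr]
  exact ⟨fun ρ τ => by rw [hadd, Matrix.mul_add, trace_add],
    fun t ρ => by rw [hsmul, Matrix.mul_smul, trace_smul]⟩

/-- Support function of the separable correlation set for `m = 2`. -/
theorem stmt1 (A B : Matrix (Fin 2) (Fin 3) ℝ)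
    (hA : ∀ i, ∑ k, A i k ^ 2 = 1) (hB : ∀ i, ∑ k, B i k ^ 2 = 1)
    (Z : Matrix (Fin 2) (Fin 2) ℝ) :
    suppFn (Csep A B) Z =
      Real.sqrt
        (((Gmat (Real.arccos (∑ k, A 0 k * A 1 k)) * Z *
            Gmat (Real.arccos (∑ k, B 0 k * B 1 k)) * Zᵀ).trace +
          norm
            (((Gmat (Real.arccos (∑ k, A 0 k * A 1 k))).map Complex.ofReal *
              Z.map Complex.ofReal *
              Hmat (Real.arccos (∑ k, B 0 k * B 1 k)) *
              (Zᵀ).map Complex.ofReal).trace)) / 2) := by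
  have hA' (i) : A i ⬝ᵥ A i = 1 := by simpa [dotProduct, sq] using hA i
  have hB' (i) : B i ⬝ᵥ B i = 1 := by simpa [dotProduct, sq] using hB i
  have hc : (A 0 ⬝ᵥ A 1) ^ 2 ≤ 1 := by simpa [hA'] using dotProduct_sq_le (A 0) (A 1)
  obtain ⟨hc₁, hc₂⟩ := abs_le.1 ((sq_le_one_iff_abs_le_one _).1 hc)
  have hG : Gmat (Real.arccos (∑ k, A 0 k * A 1 k)) = !![1, A 0 ⬝ᵥ A 1; A 0 ⬝ᵥ A 1, 1] := by
    change Gmat (Real.arccos (A 0 ⬝ᵥ A 1)) = _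
    rw [Gmat, Real.cos_arccos hc₁ hc₂]
  rw [hG]
  obtain ⟨hle, x, y, hx, hy, hxy⟩ := bilin_max hA' hB' Z
  refine IsGreatest.csSup_eq ⟨?_, ?_⟩
  · obtain ⟨ρA, hρA, htA, rfl⟩ := exists_state_blochVec_eq hx
    obtain ⟨ρB, hρB, htB, rfl⟩ := exists_state_blochVec_eq hy
    refine ⟨_, ⟨ρA ⊗ₖ ρB, subset_convexHull ℝ _ ⟨ρA, ρB, hρA, htA, hρB, htB, rfl⟩, rfl⟩, ?_⟩
    exact (trace_transpose_mul_corr_kronecker hρA.isHermitian hρB.isHermitian A B Z).trans hxy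
  · rintro _ ⟨_, ⟨ρ, hρ, rfl⟩, rfl⟩
    refine convexHull_min ?_
      (convex_halfSpace_le (isLinearMap_trace_transpose_mul_corr A B Z) _) hρ
    rintro _ ⟨ρA, ρB, hρA, htA, hρB, htB, rfl⟩
    exact (trace_transpose_mul_corr_kronecker hρA.isHermitian hρB.isHermitian A B Z).trans_le
      (hle _ _ (blochVec_dotProduct_self_le hρA htA) (blochVec_dotProduct_self_le hρB htB))

end BellCorr
end

section
/- When m = 2, the support function of the quantum correlation set satisfies, for every real 2×2 matrix Z, φ_{C_qm}(Z) = sqrt( Tr[G_α Z G_β Zᵀ] + 2·|det Z|·sin α · sin β ). -/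
open Matrix Kronecker
open scoped ENNReal ComplexOrder

namespace BellCorr

/-- The observable `v · σ` associated with a vector `v ∈ ℝ³`, written out. -/
noncomputable def spin (v : Fin 3 → ℝ) : Matrix (Fin 2) (Fin 2) ℂ :=
  !![(v 2 : ℂ), v 0 - Complex.I * v 1; v 0 + Complex.I * v 1, -v 2]

lemma obs_eq_spin {m : ℕ} (A : Matrix (Fin m) (Fin 3) ℝ) (i : Fin m) :
    obs A i = spin (A i) := by
  ext a b
  fin_cases a <;> fin_cases b <;>
    simp [obs, spin, pauli, Fin.sum_univ_three, Matrix.sum_apply] <;> ring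

lemma spin_isHermitian (v : Fin 3 → ℝ) : (spin v).IsHermitian := by
  ext a b
  fin_cases a <;> fin_cases b <;> simp [spin, Complex.ext_iff]

lemma trace_spin (v : Fin 3 → ℝ) : (spin v).trace = 0 := by
  simp [spin, Matrix.trace_fin_two]

lemma spin_mul_spin (v w : Fin 3 → ℝ) :
    spin v * spin w =
      ((v ⬝ᵥ w : ℝ) : ℂ) • (1 : Matrix (Fin 2) (Fin 2) ℂ) +
        Complex.I • spin (crossProduct v w) := by
  ext a b
  fin_cases a <;> fin_cases b <;>
    simp [spin, cross_apply, Matrix.mul_apply, Fin.sum_univ_two, dotProduct, Fin.sum_univ_three,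
      Complex.ext_iff] <;> grind

lemma spin_mul_self (v : Fin 3 → ℝ) :
    spin v * spin v = ((v ⬝ᵥ v : ℝ) : ℂ) • (1 : Matrix (Fin 2) (Fin 2) ℂ) := by
  have h0 : spin 0 = 0 := by
    ext a b
    fin_cases a <;> fin_cases b <;> simp [spin]
  rw [spin_mul_spin, cross_self, h0, smul_zero, add_zero]

lemma spin_neg (v : Fin 3 → ℝ) : spin (-v) = -spin v := by
  ext a b
  fin_cases a <;> fin_cases b <;> simp [spin] <;> ring

lemma spin_mul_spin_swap (v w : Fin 3 → ℝ) :
    spin w * spin v =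
      ((v ⬝ᵥ w : ℝ) : ℂ) • (1 : Matrix (Fin 2) (Fin 2) ℂ) -
        Complex.I • spin (crossProduct v w) := by
  rw [spin_mul_spin, dotProduct_comm, ← cross_anticomm, spin_neg, smul_neg, sub_eq_add_neg]

/-- A spin observable anticommutes with one along an orthogonal direction. -/
lemma spin_mul_spin_of_orthogonal {v w : Fin 3 → ℝ} (h : v ⬝ᵥ w = 0) :
    spin w * spin v = -(spin v * spin w) := by
  rw [spin_mul_spin_swap, spin_mul_spin, h]
  simp

/-- Variance is nonnegative: `(Tr ρX)² ≤ Tr ρX²` for a state `ρ` and Hermitian `X`. -/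
lemma sq_re_trace_mul_le {n : Type*} [Fintype n] [DecidableEq n] {ρ X : Matrix n n ℂ}
    (hρ : ρ.PosSemidef) (hρ1 : ρ.trace = 1) (hX : X.IsHermitian) :
    (ρ * X).trace.re ^ 2 ≤ (ρ * (X * X)).trace.re := by
  set t := (ρ * X).trace.re with ht
  set Y : Matrix n n ℂ := X - (t : ℂ) • 1 with hY
  have hYH : Yᴴ = Y := by
    rw [hY, conjTranspose_sub, hX.eq, conjTranspose_smul, conjTranspose_one]
    simp
  have h1 : 0 ≤ (Y * ρ * Yᴴ).trace.re :=
    (Complex.le_def.mp (hρ.mul_mul_conjTranspose_same Y).trace_nonneg).1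
  have h2 : (Y * ρ * Yᴴ).trace =
      (ρ * (X * X)).trace - 2 * t * (ρ * X).trace + t ^ 2 := by
    rw [hYH, Matrix.mul_assoc, Matrix.trace_mul_comm, Matrix.mul_assoc, hY]
    simp only [Matrix.sub_mul, Matrix.mul_sub, Matrix.smul_mul, Matrix.mul_smul, Matrix.one_mul,
      Matrix.mul_one, Matrix.trace_sub, Matrix.trace_smul, hρ1, smul_eq_mul]
    ring
  rw [h2] at h1
  have h3 : (((ρ * (X * X)).trace - 2 * t * (ρ * X).trace + t ^ 2 : ℂ)).re =
      (ρ * (X * X)).trace.re - 2 * t * t + t ^ 2 := by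
    simp [pow_two, ← ht]
  rw [h3] at h1
  nlinarith

/-- If a Hermitian projection `Q` commutes with a Hermitian `W`, and `W² = c²` on the range of `Q`
while `Tr QW = 0`, then some state attains the expectation value `c` of `W`. -/
lemma exists_state_trace_eq {n : Type*} [Fintype n] [DecidableEq n] {W Q : Matrix n n ℂ}
    {c d : ℝ} (hW : W.IsHermitian) (hQ : Q.IsHermitian) (hQQ : Q * Q = Q) (hc : 0 < c)
    (hd : 0 < d) (hQd : Q.trace = d) (hcomm : W * Q = Q * W) (hQW : (Q * W).trace = 0)
    (hWW : Q * (W * W) = ((c : ℂ) ^ 2) • Q) :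
    ∃ ρ : Matrix n n ℂ, ρ.PosSemidef ∧ ρ.trace = 1 ∧ (ρ * W).trace = c := by
  have hc' : (c : ℂ) ≠ 0 := by exact_mod_cast hc.ne'
  have hd' : (d : ℂ) ≠ 0 := by exact_mod_cast hd.ne'
  set P : Matrix n n ℂ := (1 / 2 : ℂ) • (Q + (c : ℂ)⁻¹ • (Q * W)) with hP
  have hPH : Pᴴ = P := by
    rw [hP, conjTranspose_smul, conjTranspose_add, conjTranspose_smul, conjTranspose_mul, hW.eq,
      hQ.eq, hcomm]
    simp
  have e1 : Q * (Q * W) = Q * W := by rw [← Matrix.mul_assoc, hQQ]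
  have e2 : Q * W * Q = Q * W := by rw [Matrix.mul_assoc, hcomm, e1]
  have e3 : Q * W * (Q * W) = ((c : ℂ) ^ 2) • Q := by
    rw [← Matrix.mul_assoc, e2, Matrix.mul_assoc, hWW]
  have e4 : Q * W * W = ((c : ℂ) ^ 2) • Q := by rw [Matrix.mul_assoc, hWW]
  have hPP : P * P = P := by
    rw [hP]
    simp only [Matrix.smul_mul, Matrix.mul_smul, Matrix.add_mul, Matrix.mul_add, hQQ, e1, e2, e3]
    match_scalars <;> field_simp <;> norm_num
  have hPpos : P.PosSemidef := by
    rw [← hPP]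
    nth_rewrite 1 [← hPH]
    exact posSemidef_conjTranspose_mul_self P
  refine ⟨((2 / d : ℝ) : ℂ) • P, hPpos.smul ?_, ?_, ?_⟩
  · exact_mod_cast (by positivity : (0 : ℝ) ≤ 2 / d)
  · rw [hP]
    simp only [Matrix.trace_smul, Matrix.trace_add, hQd, hQW, smul_eq_mul]
    push_cast
    field_simp
    simp
  · rw [hP]
    simp only [Matrix.smul_mul, Matrix.add_mul, e4, Matrix.trace_smul, Matrix.trace_add, hQd, hQW,
      smul_eq_mul]
    push_cast
    field_simp
    simp

/-- The Bell operator `∑ i j, Z i j • Â_i ⊗ B̂_j`. -/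
noncomputable def bellOp (A B : Matrix (Fin 2) (Fin 3) ℝ) (Z : Matrix (Fin 2) (Fin 2) ℝ) :
    Matrix (Fin 2 × Fin 2) (Fin 2 × Fin 2) ℂ :=
  ∑ i, ∑ j, (Z i j : ℂ) • (spin (A i) ⊗ₖ spin (B j))

lemma kronecker_isHermitian {M N : Matrix (Fin 2) (Fin 2) ℂ} (hM : M.IsHermitian)
    (hN : N.IsHermitian) : (M ⊗ₖ N).IsHermitian := by
  rw [Matrix.IsHermitian, conjTranspose_kronecker, hM.eq, hN.eq]

lemma bellOp_isHermitian (A B : Matrix (Fin 2) (Fin 3) ℝ) (Z : Matrix (Fin 2) (Fin 2) ℝ) :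
    (bellOp A B Z).IsHermitian := by
  rw [Matrix.IsHermitian, bellOp]
  simp only [conjTranspose_sum, conjTranspose_smul,
    (kronecker_isHermitian (spin_isHermitian _) (spin_isHermitian _)).eq]
  simp

lemma trace_bellOp (A B : Matrix (Fin 2) (Fin 3) ℝ) (Z : Matrix (Fin 2) (Fin 2) ℝ) :
    (bellOp A B Z).trace = 0 := by
  simp [bellOp, trace_kronecker, trace_spin]

lemma trace_transpose_mul_corr (A B : Matrix (Fin 2) (Fin 3) ℝ) (Z : Matrix (Fin 2) (Fin 2) ℝ)
    (ρ : Matrix (Fin 2 × Fin 2) (Fin 2 × Fin 2) ℂ) :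
    (Zᵀ * corr A B ρ).trace = (ρ * bellOp A B Z).trace.re := by
  simp only [bellOp, corr, obs_eq_spin, Fin.sum_univ_two, Matrix.mul_add, Matrix.mul_smul,
    Matrix.trace_add, Matrix.trace_smul, Matrix.trace_fin_two, Matrix.mul_apply,
    Matrix.transpose_apply, Matrix.of_apply, smul_eq_mul, Complex.add_re, Complex.re_ofReal_mul]
  ring

lemma bellOp_mul_self {A B : Matrix (Fin 2) (Fin 3) ℝ} (hA : ∀ i, A i ⬝ᵥ A i = 1)
    (hB : ∀ i, B i ⬝ᵥ B i = 1) (Z : Matrix (Fin 2) (Fin 2) ℝ) :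
    bellOp A B Z * bellOp A B Z =
      (((!![1, A 0 ⬝ᵥ A 1; A 0 ⬝ᵥ A 1, 1] * Z * !![1, B 0 ⬝ᵥ B 1; B 0 ⬝ᵥ B 1, 1] * Zᵀ).trace : ℝ)
          : ℂ) • 1 -
        ((2 * Z.det : ℝ) : ℂ) •
          (spin (crossProduct (A 0) (A 1)) ⊗ₖ spin (crossProduct (B 0) (B 1))) := by
  simp only [bellOp, Fin.sum_univ_two, Matrix.mul_add, Matrix.add_mul, Matrix.smul_mul,
    Matrix.mul_smul, ← mul_kronecker_mul, spin_mul_self, hA, hB, spin_mul_spin (A 0) (A 1),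
    spin_mul_spin (B 0) (B 1), spin_mul_spin_swap (A 0) (A 1), spin_mul_spin_swap (B 0) (B 1)]
  simp only [add_kronecker, kronecker_add, sub_eq_add_neg, ← neg_smul, smul_kronecker,
    kronecker_smul, one_kronecker_one, Matrix.trace_fin_two, Matrix.mul_apply,
    Fin.sum_univ_two, Matrix.det_fin_two]
  simp
  match_scalars <;> ring_nf <;> simp <;> ring

lemma commute_bellOp_kronecker {A B : Matrix (Fin 2) (Fin 3) ℝ} {u v : Fin 3 → ℝ}
    (hu : ∀ i, u ⬝ᵥ A i = 0) (hv : ∀ j, v ⬝ᵥ B j = 0) (Z : Matrix (Fin 2) (Fin 2) ℝ) :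
    bellOp A B Z * (spin u ⊗ₖ spin v) = (spin u ⊗ₖ spin v) * bellOp A B Z := by
  simp only [bellOp, Matrix.sum_mul, Matrix.mul_sum, Matrix.smul_mul, Matrix.mul_smul,
    ← mul_kronecker_mul, spin_mul_spin_of_orthogonal (hu _), spin_mul_spin_of_orthogonal (hv _)]
  refine Finset.sum_congr rfl fun i _ => Finset.sum_congr rfl fun j _ => ?_
  congr 1
  ext a b
  simp [kroneckerMap_apply]

lemma trace_kronecker_mul_bellOp {A B : Matrix (Fin 2) (Fin 3) ℝ} {u v : Fin 3 → ℝ}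
    (hu : ∀ i, u ⬝ᵥ A i = 0) (Z : Matrix (Fin 2) (Fin 2) ℝ) :
    ((spin u ⊗ₖ spin v) * bellOp A B Z).trace = 0 := by
  simp only [bellOp, Matrix.mul_sum, Matrix.mul_smul, ← mul_kronecker_mul, Matrix.trace_sum,
    Matrix.trace_smul, trace_kronecker, spin_mul_spin u, hu]
  simp [trace_spin]

lemma cross_dotProduct_row (A : Matrix (Fin 2) (Fin 3) ℝ) (i : Fin 2) :
    crossProduct (A 0) (A 1) ⬝ᵥ A i = 0 := by
  rw [dotProduct_comm]
  fin_cases i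
  · exact dot_self_cross _ _
  · exact dot_cross_self _ _

/-- For unit vectors, the sine of the enclosed angle is the length of the cross product. -/
lemma cross_dotProduct_self_of_unit {v w : Fin 3 → ℝ} (hv : v ⬝ᵥ v = 1) (hw : w ⬝ᵥ w = 1) :
    crossProduct v w ⬝ᵥ crossProduct v w = Real.sin (Real.arccos (v ⬝ᵥ w)) ^ 2 ∧
      Real.cos (Real.arccos (v ⬝ᵥ w)) = v ⬝ᵥ w := by
  have h : crossProduct v w ⬝ᵥ crossProduct v w = 1 - (v ⬝ᵥ w) ^ 2 := by
    rw [cross_dot_cross, hv, hw, dotProduct_comm w v]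
    ring
  have h0 : 0 ≤ 1 - (v ⬝ᵥ w) ^ 2 := by
    rw [← h]
    exact Finset.sum_nonneg fun i _ => mul_self_nonneg _
  refine ⟨by rw [h, Real.sin_arccos, Real.sq_sqrt h0], ?_⟩
  exact Real.cos_arccos (by nlinarith) (by nlinarith)

/-- Support function of the quantum correlation set for `m = 2`. -/
theorem stmt3 (A B : Matrix (Fin 2) (Fin 3) ℝ)
    (hA : ∀ i, ∑ k, A i k ^ 2 = 1) (hB : ∀ i, ∑ k, B i k ^ 2 = 1)
    (Z : Matrix (Fin 2) (Fin 2) ℝ) :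
    suppFn (Cqm A B) Z =
      Real.sqrt
        ((Gmat (Real.arccos (∑ k, A 0 k * A 1 k)) * Z *
            Gmat (Real.arccos (∑ k, B 0 k * B 1 k)) * Zᵀ).trace +
          2 * |Z.det| * Real.sin (Real.arccos (∑ k, A 0 k * A 1 k)) *
            Real.sin (Real.arccos (∑ k, B 0 k * B 1 k))) := by
  have hA' : ∀ i, A i ⬝ᵥ A i = 1 := fun i => by
    rw [← hA i]; exact Finset.sum_congr rfl fun k _ => (sq _).symm
  have hB' : ∀ i, B i ⬝ᵥ B i = 1 := fun i => by
    rw [← hB i]; exact Finset.sum_congr rfl fun k _ => (sq _).symm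
  change suppFn (Cqm A B) Z = Real.sqrt
    ((Gmat (Real.arccos (A 0 ⬝ᵥ A 1)) * Z * Gmat (Real.arccos (B 0 ⬝ᵥ B 1)) * Zᵀ).trace +
      2 * |Z.det| * Real.sin (Real.arccos (A 0 ⬝ᵥ A 1)) * Real.sin (Real.arccos (B 0 ⬝ᵥ B 1)))
  obtain ⟨hu, hcA⟩ := cross_dotProduct_self_of_unit (hA' 0) (hA' 1)
  obtain ⟨hv, hcB⟩ := cross_dotProduct_self_of_unit (hB' 0) (hB' 1)
  have hWW := bellOp_mul_self hA' hB' Z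
  simp only [Gmat, hcA, hcB]
  have hsA : 0 ≤ Real.sin (Real.arccos (A 0 ⬝ᵥ A 1)) := by
    rw [Real.sin_arccos]; positivity
  have hsB : 0 ≤ Real.sin (Real.arccos (B 0 ⬝ᵥ B 1)) := by
    rw [Real.sin_arccos]; positivity
  have huA := cross_dotProduct_row A
  have hvB := cross_dotProduct_row B
  set sA := Real.sin (Real.arccos (A 0 ⬝ᵥ A 1))
  set sB := Real.sin (Real.arccos (B 0 ⬝ᵥ B 1))
  set u := crossProduct (A 0) (A 1)
  set v := crossProduct (B 0) (B 1)
  set T := (!![1, A 0 ⬝ᵥ A 1; A 0 ⬝ᵥ A 1, 1] * Z * !![1, B 0 ⬝ᵥ B 1; B 0 ⬝ᵥ B 1, 1] * Zᵀ).trace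
  set W := bellOp A B Z with hW
  set K := spin u ⊗ₖ spin v with hK
  have hWH : W.IsHermitian := bellOp_isHermitian A B Z
  have hKH : K.IsHermitian := kronecker_isHermitian (spin_isHermitian _) (spin_isHermitian _)
  have hKK : K * K = (((sA * sB) ^ 2 : ℝ) : ℂ) • 1 := by
    rw [hK, ← mul_kronecker_mul, spin_mul_self, spin_mul_self, hu, hv, smul_kronecker,
      kronecker_smul, one_kronecker_one, smul_smul]
    push_cast
    ring_nf
  have hWtr : W.trace = 0 := trace_bellOp A B Z
  have hKtr : K.trace = 0 := by rw [hK, trace_kronecker, trace_spin, zero_mul]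
  have hs : 0 ≤ sA * sB := mul_nonneg hsA hsB
  have key : ∀ ρ ∈ Sqm, (ρ * W).trace.re ^ 2 ≤ T + 2 * |Z.det| * sA * sB := by
    rintro ρ ⟨hρ, hρ1⟩
    have h1 := sq_re_trace_mul_le hρ hρ1 hWH
    have h2 := sq_re_trace_mul_le hρ hρ1 hKH
    rw [hWW, Matrix.mul_sub, Matrix.mul_smul, Matrix.mul_smul, Matrix.mul_one, Matrix.trace_sub,
      Matrix.trace_smul, Matrix.trace_smul, hρ1, smul_eq_mul, smul_eq_mul, Complex.sub_re,
      Complex.re_ofReal_mul, Complex.re_ofReal_mul, Complex.one_re] at h1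
    rw [hKK, Matrix.mul_smul, Matrix.mul_one, Matrix.trace_smul, hρ1, smul_eq_mul,
      Complex.re_ofReal_mul, Complex.one_re, mul_one] at h2
    have h3 : |(ρ * K).trace.re| ≤ sA * sB := abs_le_of_sq_le_sq h2 hs
    have h4 : -(Z.det * (ρ * K).trace.re) ≤ |Z.det| * (sA * sB) := by
      refine (neg_le_abs _).trans ?_
      rw [abs_mul]
      exact mul_le_mul_of_nonneg_left h3 (abs_nonneg _)
    linarith
  have hmax : (4⁻¹ : ℂ) • (1 : Matrix (Fin 2 × Fin 2) (Fin 2 × Fin 2) ℂ) ∈ Sqm := by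
    refine ⟨PosSemidef.one.smul ?_, ?_⟩
    · rw [Complex.le_def]; norm_num
    · rw [Matrix.trace_smul, Matrix.trace_one]; norm_num
  have hL : 0 ≤ T + 2 * |Z.det| * sA * sB := (sq_nonneg _).trans (key _ hmax)
  have hLsq := Real.sq_sqrt hL
  set c := Real.sqrt (T + 2 * |Z.det| * sA * sB)
  have hc0 : 0 ≤ c := Real.sqrt_nonneg _
  have hex : ∃ ρ ∈ Sqm, (ρ * W).trace.re = c := by
    rcases hc0.eq_or_lt with hc | hc
    · exact ⟨_, hmax, by rw [Matrix.smul_mul, Matrix.one_mul, Matrix.trace_smul, hWtr, ← hc]; simp⟩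
    suffices h : ∃ ρ : Matrix (Fin 2 × Fin 2) (Fin 2 × Fin 2) ℂ,
        ρ.PosSemidef ∧ ρ.trace = 1 ∧ (ρ * W).trace = c by
      obtain ⟨ρ, h1, h2, h3⟩ := h
      exact ⟨ρ, ⟨h1, h2⟩, by rw [h3, Complex.ofReal_re]⟩
    have hscal : ((c : ℂ) ^ 2) = ((T + 2 * |Z.det| * sA * sB : ℝ) : ℂ) := by
      rw [← hLsq]; push_cast; rfl
    rcases hs.eq_or_lt with hs0 | hs0
    · have hK0 : K = 0 := by
        rw [← Matrix.conjTranspose_mul_self_eq_zero, hKH.eq, hKK, ← hs0]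
        simp
      refine exists_state_trace_eq (Q := 1) (d := 4) hWH isHermitian_one (one_mul 1) hc
        (by norm_num) (by simp [Matrix.trace_one]) (by simp) (by simpa using hWtr) ?_
      rw [one_mul, hWW, hK0, smul_zero, sub_zero, hscal, mul_assoc _ sA, ← hs0, mul_zero, add_zero]
    · obtain ⟨ε, hε, hεd⟩ : ∃ ε : ℝ, ε * ε = 1 ∧ Z.det = -ε * |Z.det| := by
        rcases abs_cases Z.det with ⟨h, _⟩ | ⟨h, _⟩
        · exact ⟨-1, by norm_num, by rw [h]; ring⟩
        · exact ⟨1, by norm_num, by rw [h]; ring⟩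
      have hsA0 : sA ≠ 0 := left_ne_zero_of_mul hs0.ne'
      have hsB0 : sB ≠ 0 := right_ne_zero_of_mul hs0.ne'
      set r : ℂ := ((ε / (sA * sB) : ℝ) : ℂ) with hr
      have hrr : r * r * (((sA * sB) ^ 2 : ℝ) : ℂ) = 1 := by
        rw [hr]
        norm_cast
        field_simp
        rw [sq, hε]
      have hdr : ((2 * Z.det : ℝ) : ℂ) = -((2 * |Z.det| * sA * sB : ℝ) : ℂ) * r := by
        rw [hr, ← Complex.ofReal_neg, ← Complex.ofReal_mul]
        congr 1
        nth_rewrite 1 [hεd]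
        rw [mul_assoc _ sA]
        field_simp
      have hcommK : W * K = K * W := commute_bellOp_kronecker huA hvB Z
      have hKW : (K * W).trace = 0 := trace_kronecker_mul_bellOp huA Z
      refine exists_state_trace_eq (Q := (1 / 2 : ℂ) • (1 + r • K)) (d := 2) hWH ?_ ?_ hc
        (by norm_num) ?_ ?_ ?_ ?_
      · rw [Matrix.IsHermitian, conjTranspose_smul, conjTranspose_add, conjTranspose_smul, hKH.eq,
          conjTranspose_one, hr]
        simp
      · simp only [Matrix.smul_mul, Matrix.mul_smul, Matrix.add_mul, Matrix.mul_add, Matrix.one_mul,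
          Matrix.mul_one, hKK]
        match_scalars
        · push_cast at hrr ⊢
          linear_combination (1 / 4 : ℂ) * hrr
        · ring
      · rw [Matrix.trace_smul, Matrix.trace_add, Matrix.trace_smul, hKtr, Matrix.trace_one]
        simp
        norm_num
      · simp only [Matrix.smul_mul, Matrix.mul_smul, Matrix.add_mul, Matrix.mul_add, Matrix.one_mul,
          Matrix.mul_one, hcommK]
      · simp only [Matrix.smul_mul, Matrix.add_mul, Matrix.one_mul, Matrix.trace_smul,
          Matrix.trace_add, hWtr, hKW, smul_zero, add_zero]
      · rw [hWW, hscal, hdr]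
        simp only [Matrix.smul_mul, Matrix.mul_smul, Matrix.add_mul, Matrix.mul_sub, Matrix.one_mul,
          Matrix.mul_one, hKK]
        match_scalars
        · push_cast at hrr ⊢
          linear_combination (|Z.det| * sA * sB : ℂ) * hrr
        · ring
  refine IsGreatest.csSup_eq ⟨?_, ?_⟩
  · obtain ⟨ρ, hρ, h⟩ := hex
    exact ⟨corr A B ρ, ⟨ρ, hρ, rfl⟩, by simp only [trace_transpose_mul_corr, ← hW, h]⟩
  · rintro _ ⟨_, ⟨ρ, hρ, rfl⟩, rfl⟩
    simp only [trace_transpose_mul_corr, ← hW]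
    exact Real.le_sqrt_of_sq_le (key ρ hρ)

end BellCorr
end

section
/- When m = 2, the quantum correlation set and the maximal correlation set coincide: C_qm = C_max. -/
open Matrix Kronecker
open scoped ENNReal ComplexOrder

namespace BellCorr

/-- The matrix `∑ k, v k • σ_k` associated with a vector `v`. -/
noncomputable def pauliVec (v : Fin 3 → ℝ) : Matrix (Fin 2) (Fin 2) ℂ :=
  ∑ k : Fin 3, (v k : ℂ) • pauli k

lemma obs_eq_pauliVec {m : ℕ} (A : Matrix (Fin m) (Fin 3) ℝ) (i : Fin m) :
    obs A i = pauliVec (A i) := rfl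

lemma pauliVec_eq (v : Fin 3 → ℝ) :
    pauliVec v = !![(v 2 : ℂ), v 0 - v 1 * Complex.I; v 0 + v 1 * Complex.I, -v 2] := by
  ext i j
  fin_cases i <;> fin_cases j <;> simp [pauliVec, pauli, Fin.sum_univ_three, sub_eq_add_neg]

lemma pauliVec_comb (a b : ℝ) (x y : Fin 3 → ℝ) :
    pauliVec (a • x + b • y) = a • pauliVec x + b • pauliVec y := by
  simp only [pauliVec_eq]
  ext i j
  fin_cases i <;> fin_cases j <;> simp <;> ring

lemma pauliVec_isHermitian (v : Fin 3 → ℝ) : (pauliVec v).IsHermitian := by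
  rw [pauliVec_eq]
  ext i j
  fin_cases i <;> fin_cases j <;> simp [sub_eq_add_neg]

lemma trace_pauliVec (v : Fin 3 → ℝ) : (pauliVec v).trace = 0 := by
  simp [pauliVec_eq, Matrix.trace_fin_two]

lemma pauliVec_mul_add_mul (x y : Fin 3 → ℝ) :
    pauliVec x * pauliVec y + pauliVec y * pauliVec x
      = (2 * (x ⬝ᵥ y)) • (1 : Matrix (Fin 2) (Fin 2) ℂ) := by
  simp only [pauliVec_eq, dotProduct, Fin.sum_univ_three]
  ext i j
  fin_cases i <;> fin_cases j <;> simp <;> ring_nf <;> simp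

lemma pauliVec_mul_self {x : Fin 3 → ℝ} (hx : x ⬝ᵥ x = 1) : pauliVec x * pauliVec x = 1 := by
  have h := pauliVec_mul_add_mul x x
  rw [hx, ← two_smul ℝ, mul_one] at h
  exact smul_right_injective _ (two_ne_zero (α := ℝ)) h

lemma pauliVec_mul_comm_of_orthogonal {x y : Fin 3 → ℝ} (h : x ⬝ᵥ y = 0) :
    pauliVec x * pauliVec y = -(pauliVec y * pauliVec x) := by
  have := pauliVec_mul_add_mul x y
  rw [h, mul_zero, zero_smul] at this
  exact eq_neg_of_add_eq_zero_left this

lemma trace_pauliVec_mul (x y : Fin 3 → ℝ) :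
    (pauliVec x * pauliVec y).trace = ((2 * (x ⬝ᵥ y) : ℝ) : ℂ) := by
  simp only [pauliVec_eq, dotProduct, Fin.sum_univ_three, Matrix.trace_fin_two]
  simp
  ring_nf
  simp

/-- The correlation of `ρ` in the directions `x` and `y`. -/
noncomputable def dirCorr (ρ : Matrix (Fin 2 × Fin 2) (Fin 2 × Fin 2) ℂ) (x y : Fin 3 → ℝ) : ℝ :=
  ((ρ * (pauliVec x ⊗ₖ pauliVec y)).trace).re

lemma corr_apply {m : ℕ} (A B : Matrix (Fin m) (Fin 3) ℝ)
    (ρ : Matrix (Fin 2 × Fin 2) (Fin 2 × Fin 2) ℂ) (i j : Fin m) :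
    corr A B ρ i j = dirCorr ρ (A i) (B j) := rfl

lemma dirCorr_comb_left (ρ : Matrix (Fin 2 × Fin 2) (Fin 2 × Fin 2) ℂ) (a b : ℝ)
    (x y z : Fin 3 → ℝ) :
    dirCorr ρ (a • x + b • y) z = a * dirCorr ρ x z + b * dirCorr ρ y z := by
  simp [dirCorr, pauliVec_comb, add_kronecker, smul_kronecker, mul_add, trace_add]

lemma dirCorr_comb_right (ρ : Matrix (Fin 2 × Fin 2) (Fin 2 × Fin 2) ℂ) (a b : ℝ)
    (x y z : Fin 3 → ℝ) :
    dirCorr ρ z (a • x + b • y) = a * dirCorr ρ z x + b * dirCorr ρ z y := by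
  simp [dirCorr, pauliVec_comb, kronecker_add, kronecker_smul, mul_add, trace_add]

/-! ### Quantum states are maximal states -/

open scoped MatrixOrder in
lemma trace_mul_re_nonneg {n : Type*} [Fintype n] [DecidableEq n] {M N : Matrix n n ℂ}
    (hM : M.PosSemidef) (hN : N.PosSemidef) : 0 ≤ ((M * N).trace).re := by
  obtain ⟨X, rfl⟩ : ∃ X, N = X * Xᴴ := by
    obtain ⟨Y, rfl⟩ := CStarAlgebra.nonneg_iff_eq_star_mul_self.mp hN.nonneg
    exact ⟨Yᴴ, by simp [star_eq_conjTranspose]⟩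
  rw [← mul_assoc, trace_mul_comm, ← mul_assoc]
  exact (Complex.le_def.mp (hM.conjTranspose_mul_mul_same X).trace_nonneg).1

lemma Sqm_subset_Smax : Sqm ⊆ Smax := fun _ ⟨hρ, htr⟩ =>
  ⟨hρ.isHermitian, htr, fun _ _ hP hQ => trace_mul_re_nonneg hρ (hP.kronecker hQ)⟩

/-! ### Correlations of maximal states are bounded -/

lemma posSemidef_one_add_pauliVec {x : Fin 3 → ℝ} (hx : x ⬝ᵥ x = 1) (ε : ℝ) (hε : ε ^ 2 = 1) :
    (1 + ε • pauliVec x).PosSemidef := by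
  have hH : (1 + ε • pauliVec x)ᴴ = 1 + ε • pauliVec x := by
    simp [(pauliVec_isHermitian x).eq]
  have h : 1 + ε • pauliVec x
      = (2⁻¹ : ℝ) • ((1 + ε • pauliVec x)ᴴ * (1 + ε • pauliVec x)) := by
    rw [hH]
    simp only [mul_add, add_mul, one_mul, mul_one, smul_mul_smul_comm, pauliVec_mul_self hx,
      ← pow_two ε, hε]
    module
  rw [h]
  exact (posSemidef_conjTranspose_mul_self _).smul (by norm_num)

lemma one_add_mul_dirCorr_nonneg {ρ : Matrix (Fin 2 × Fin 2) (Fin 2 × Fin 2) ℂ} (hρ : ρ ∈ Smax)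
    {x y : Fin 3 → ℝ} (hx : x ⬝ᵥ x = 1) (hy : y ⬝ᵥ y = 1) (ε : ℝ) (hε : ε ^ 2 = 1) :
    0 ≤ 1 + ε * dirCorr ρ x y := by
  obtain ⟨-, htr, hpos⟩ := hρ
  have h₁ := hpos _ _ (posSemidef_one_add_pauliVec hx 1 (by norm_num))
    (posSemidef_one_add_pauliVec hy ε hε)
  have h₂ := hpos _ _ (posSemidef_one_add_pauliVec hx (-1) (by norm_num))
    (posSemidef_one_add_pauliVec hy (-ε) (by rwa [neg_sq]))
  simp only [add_kronecker, kronecker_add, smul_kronecker, kronecker_smul, mul_add, trace_add,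
    mul_smul_comm, trace_smul, one_kronecker_one, mul_one, htr, Complex.add_re, Complex.smul_re,
    Complex.one_re, smul_eq_mul] at h₁ h₂
  rw [dirCorr]
  linarith

lemma abs_dirCorr_le_one {ρ : Matrix (Fin 2 × Fin 2) (Fin 2 × Fin 2) ℂ} (hρ : ρ ∈ Smax)
    {x y : Fin 3 → ℝ} (hx : x ⬝ᵥ x = 1) (hy : y ⬝ᵥ y = 1) : |dirCorr ρ x y| ≤ 1 := by
  have h₁ := one_add_mul_dirCorr_nonneg hρ hx hy 1 (by norm_num)
  have h₂ := one_add_mul_dirCorr_nonneg hρ hx hy (-1) (by norm_num)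
  exact abs_le.mpr ⟨by linarith, by linarith⟩

/-! ### Orthonormal frames -/

/-- `p` and `q` are orthonormal vectors whose span contains the rows of `A`. -/
structure IsFrame (A : Matrix (Fin 2) (Fin 3) ℝ) (p q : Fin 3 → ℝ) : Prop where
  left : p ⬝ᵥ p = 1
  right : q ⬝ᵥ q = 1
  orthogonal : p ⬝ᵥ q = 0
  span : ∀ i, ∃ a b : ℝ, A i = a • p + b • q

lemma dotProduct_self_pos {v : Fin 3 → ℝ} (hv : v ≠ 0) : 0 < v ⬝ᵥ v :=
  lt_of_le_of_ne (Finset.sum_nonneg fun _ _ => mul_self_nonneg _)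
    fun h => hv (dotProduct_self_eq_zero.mp h.symm)

lemma exists_ne_zero_orthogonal (p : Fin 3 → ℝ) : ∃ v : Fin 3 → ℝ, v ≠ 0 ∧ p ⬝ᵥ v = 0 := by
  by_cases h : p 0 = 0
  · exact ⟨![1, 0, 0], fun h' => one_ne_zero (congrFun h' 0), by
      simp [dotProduct, Fin.sum_univ_three, h]⟩
  · exact ⟨![-p 1, p 0, 0], fun h' => h (congrFun h' 1), by
      simp [dotProduct, Fin.sum_univ_three]; ring⟩

lemma exists_isFrame (A : Matrix (Fin 2) (Fin 3) ℝ) (hA : A 0 ⬝ᵥ A 0 = 1) :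
    ∃ p q, IsFrame A p q := by
  set p := A 0 with hp
  obtain ⟨v, hv, hpv, c, d, hcd⟩ : ∃ v : Fin 3 → ℝ, v ≠ 0 ∧ p ⬝ᵥ v = 0 ∧
      ∃ c d : ℝ, A 1 = c • p + d • v := by
    by_cases h : A 1 - (p ⬝ᵥ A 1) • p = 0
    · obtain ⟨v, hv, hpv⟩ := exists_ne_zero_orthogonal p
      exact ⟨v, hv, hpv, p ⬝ᵥ A 1, 0, by rw [zero_smul, add_zero]; exact sub_eq_zero.mp h⟩
    · exact ⟨_, h, by simp [dotProduct_sub, dotProduct_smul, hA], p ⬝ᵥ A 1, 1, by module⟩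
  have hpos := dotProduct_self_pos hv
  have hr := Real.sqrt_pos.mpr hpos
  have hsq := Real.mul_self_sqrt hpos.le
  refine ⟨p, (√(v ⬝ᵥ v))⁻¹ • v, hA, ?_, ?_, ?_⟩
  · rw [dotProduct_smul, smul_dotProduct, smul_eq_mul, smul_eq_mul]
    field_simp
    nlinarith
  · rw [dotProduct_smul, hpv, smul_zero]
  · intro i
    fin_cases i
    · exact ⟨1, 0, by simp [hp]⟩
    · refine ⟨c, d * √(v ⬝ᵥ v), ?_⟩
      rw [smul_smul, mul_assoc, mul_inv_cancel₀ hr.ne', mul_one]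
      exact hcd

lemma IsFrame.rotate {A : Matrix (Fin 2) (Fin 3) ℝ} {p q : Fin 3 → ℝ} (h : IsFrame A p q)
    (θ : ℝ) : IsFrame A (Real.cos θ • p + Real.sin θ • q) (-Real.sin θ • p + Real.cos θ • q) := by
  have hqp : q ⬝ᵥ p = 0 := by rw [dotProduct_comm, h.orthogonal]
  have hcs := Real.sin_sq_add_cos_sq θ
  refine ⟨?_, ?_, ?_, fun i => ?_⟩
  · simp only [add_dotProduct, dotProduct_add, smul_dotProduct, dotProduct_smul, h.left, h.right,
      h.orthogonal, hqp, smul_eq_mul]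
    linarith
  · simp only [add_dotProduct, dotProduct_add, smul_dotProduct, dotProduct_smul, h.left, h.right,
      h.orthogonal, hqp, smul_eq_mul]
    linarith
  · simp only [add_dotProduct, dotProduct_add, smul_dotProduct, dotProduct_smul, h.left, h.right,
      h.orthogonal, hqp, smul_eq_mul]
    ring
  · obtain ⟨a, b, hab⟩ := h.span i
    refine ⟨a * Real.cos θ + b * Real.sin θ, -a * Real.sin θ + b * Real.cos θ, ?_⟩
    rw [hab]
    ext k
    simp only [Pi.add_apply, Pi.smul_apply, smul_eq_mul]
    linear_combination (-a * p k - b * q k) * hcs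

lemma exists_mul_sin_add_mul_cos_eq_zero (x y : ℝ) :
    ∃ ψ : ℝ, x * Real.sin ψ + y * Real.cos ψ = 0 := by
  refine ⟨-(Complex.mk x y).arg, ?_⟩
  have hx := Complex.norm_mul_cos_arg (Complex.mk x y)
  have hy := Complex.norm_mul_sin_arg (Complex.mk x y)
  simp only at hx hy
  rw [Real.sin_neg, Real.cos_neg]
  linear_combination Real.sin (Complex.mk x y).arg * hx - Real.cos (Complex.mk x y).arg * hy

/-- Singular value decomposition of the restriction of the correlation form to two planes. -/
lemma exists_isFrame_dirCorr_eq_zero (ρ : Matrix (Fin 2 × Fin 2) (Fin 2 × Fin 2) ℂ)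
    {A B : Matrix (Fin 2) (Fin 3) ℝ} (hA : A 0 ⬝ᵥ A 0 = 1) (hB : B 0 ⬝ᵥ B 0 = 1) :
    ∃ p q r s, IsFrame A p q ∧ IsFrame B r s ∧ dirCorr ρ p s = 0 ∧ dirCorr ρ q r = 0 := by
  obtain ⟨p, q, hpq⟩ := exists_isFrame A hA
  obtain ⟨r, s, hrs⟩ := exists_isFrame B hB
  obtain ⟨ψ, hψ⟩ := exists_mul_sin_add_mul_cos_eq_zero
    (dirCorr ρ q s - dirCorr ρ p r) (dirCorr ρ p s + dirCorr ρ q r)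
  obtain ⟨χ, hχ⟩ := exists_mul_sin_add_mul_cos_eq_zero
    (dirCorr ρ p r + dirCorr ρ q s) (dirCorr ρ p s - dirCorr ρ q r)
  obtain ⟨θ, φ, rfl, rfl⟩ : ∃ θ φ : ℝ, ψ = θ + φ ∧ χ = θ - φ :=
    ⟨(ψ + χ) / 2, (ψ - χ) / 2, by ring, by ring⟩
  rw [Real.sin_add, Real.cos_add] at hψ
  rw [Real.sin_sub, Real.cos_sub] at hχ
  refine ⟨_, _, _, _, hpq.rotate θ, hrs.rotate φ, ?_, ?_⟩
  · simp only [dirCorr_comb_left, dirCorr_comb_right]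
    linear_combination (hψ + hχ) / 2
  · simp only [dirCorr_comb_left, dirCorr_comb_right]
    linear_combination (hψ - hχ) / 2

/-! ### A quantum state with prescribed correlations -/

lemma exists_sq_add_sq_eq_one_two_mul {s : ℝ} (hs : |s| ≤ 1) :
    ∃ a b : ℝ, a ^ 2 + b ^ 2 = 1 ∧ 2 * a * b = s := by
  obtain ⟨h₁, h₂⟩ := abs_le.mp hs
  refine ⟨Real.sin (Real.arcsin s / 2), Real.cos (Real.arcsin s / 2),
    Real.sin_sq_add_cos_sq _, ?_⟩
  rw [← Real.sin_two_mul, mul_div_cancel₀ _ two_ne_zero, Real.sin_arcsin h₁ h₂]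

lemma posSemidef_one_add_mul_one_add {n : Type*} [Fintype n] [DecidableEq n]
    {Z₁ Z₂ : Matrix n n ℂ} (h₁ : Z₁.IsHermitian) (h₂ : Z₂.IsHermitian)
    (hZ₁ : Z₁ * Z₁ = 1) (hZ₂ : Z₂ * Z₂ = 1) (hZ : Commute Z₁ Z₂)
    {s₁ s₂ : ℝ} (hs₁ : |s₁| ≤ 1) (hs₂ : |s₂| ≤ 1) :
    ((1 + s₁ • Z₁) * (1 + s₂ • Z₂)).PosSemidef := by
  have key : ∀ {Z : Matrix n n ℂ} {a b : ℝ}, Z * Z = 1 → a ^ 2 + b ^ 2 = 1 →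
      (a • 1 + b • Z) * (a • 1 + b • Z) = 1 + (2 * a * b) • Z := by
    intro Z a b hZ hab
    simp only [mul_add, add_mul, smul_mul_smul_comm, one_mul, mul_one, hZ]
    have h := congrArg (· • (1 : Matrix n n ℂ)) hab
    simp only [add_smul, one_smul] at h
    refine Eq.trans ?_ (congrArg (· + (2 * a * b) • Z) h)
    module
  obtain ⟨a, b, hab, rfl⟩ := exists_sq_add_sq_eq_one_two_mul hs₁
  obtain ⟨c, d, hcd, rfl⟩ := exists_sq_add_sq_eq_one_two_mul hs₂
  set U := a • 1 + b • Z₁ with hU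
  set V := c • 1 + d • Z₂ with hV
  have hUV : Commute U V := by
    refine Commute.add_left ?_ ?_ <;> refine Commute.add_right ?_ ?_
    · exact ((Commute.one_left _).smul_left _).smul_right _
    · exact ((Commute.one_left _).smul_left _).smul_right _
    · exact ((Commute.one_right _).smul_left _).smul_right _
    · exact (hZ.smul_left _).smul_right _
  have hUH : Uᴴ = U := by simp [hU, h₁.eq]
  have hVH : Vᴴ = V := by simp [hV, h₂.eq]
  have h : (1 + (2 * a * b) • Z₁) * (1 + (2 * c * d) • Z₂) = (U * V)ᴴ * (U * V) := by
    rw [← key hZ₁ hab, ← key hZ₂ hcd, conjTranspose_mul, hUH, hVH, ← hU, ← hV, ← hUV.eq]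
    exact hUV.mul_mul_mul_comm U V
  rw [h]
  exact posSemidef_conjTranspose_mul_self _

lemma trace_pauliVec_mul_mul_eq_zero {p q : Fin 3 → ℝ} (hp : p ⬝ᵥ p = 1) (hq : q ⬝ᵥ q = 1)
    (a b : ℝ) : (pauliVec p * pauliVec q * pauliVec (a • p + b • q)).trace = 0 := by
  have h₁ : (pauliVec p * pauliVec q * pauliVec p).trace = 0 := by
    rw [trace_mul_comm, ← mul_assoc, pauliVec_mul_self hp, one_mul, trace_pauliVec]
  have h₂ : (pauliVec p * pauliVec q * pauliVec q).trace = 0 := by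
    rw [mul_assoc, pauliVec_mul_self hq, mul_one, trace_pauliVec]
  simp [pauliVec_comb, mul_add, trace_add, h₁, h₂]

lemma exists_mem_Sqm_dirCorr {A B : Matrix (Fin 2) (Fin 3) ℝ} {p q r s : Fin 3 → ℝ}
    (hA : IsFrame A p q) (hB : IsFrame B r s) {s₁ s₂ : ℝ} (hs₁ : |s₁| ≤ 1) (hs₂ : |s₂| ≤ 1) :
    ∃ ρ ∈ Sqm, ∀ a b c d : ℝ,
      dirCorr ρ (a • p + b • q) (c • r + d • s) = a * c * s₁ + b * d * s₂ := by
  have hqp : q ⬝ᵥ p = 0 := by rw [dotProduct_comm, hA.orthogonal]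
  have hsr : s ⬝ᵥ r = 0 := by rw [dotProduct_comm, hB.orthogonal]
  refine ⟨(4⁻¹ : ℝ) • ((1 + s₁ • (pauliVec p ⊗ₖ pauliVec r)) *
    (1 + s₂ • (pauliVec q ⊗ₖ pauliVec s))), ⟨?_, ?_⟩, fun a b c d => ?_⟩
  · refine (posSemidef_one_add_mul_one_add ?_ ?_ ?_ ?_ ?_ hs₁ hs₂).smul (by norm_num)
    · rw [IsHermitian, conjTranspose_kronecker, (pauliVec_isHermitian p).eq,
        (pauliVec_isHermitian r).eq]
    · rw [IsHermitian, conjTranspose_kronecker, (pauliVec_isHermitian q).eq,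
        (pauliVec_isHermitian s).eq]
    · rw [← mul_kronecker_mul, pauliVec_mul_self hA.left, pauliVec_mul_self hB.left,
        one_kronecker_one]
    · rw [← mul_kronecker_mul, pauliVec_mul_self hA.right, pauliVec_mul_self hB.right,
        one_kronecker_one]
    · rw [Commute, SemiconjBy, ← mul_kronecker_mul, ← mul_kronecker_mul,
        pauliVec_mul_comm_of_orthogonal hA.orthogonal,
        pauliVec_mul_comm_of_orthogonal hB.orthogonal]
      ext
      simp
  · simp only [mul_add, add_mul, one_mul, mul_one, smul_mul_smul_comm, ← mul_kronecker_mul,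
      trace_smul, trace_add, trace_kronecker, trace_pauliVec, trace_pauliVec_mul, hA.orthogonal,
      trace_one]
    norm_num
  · set x := a • p + b • q with hx
    set y := c • r + d • s with hy
    have hpx : p ⬝ᵥ x = a := by simp [hx, hA.left, hA.orthogonal]
    have hqx : q ⬝ᵥ x = b := by simp [hx, hA.right, hqp]
    have hry : r ⬝ᵥ y = c := by simp [hy, hB.left, hB.orthogonal]
    have hsy : s ⬝ᵥ y = d := by simp [hy, hB.right, hsr]
    have h0 : (pauliVec p * pauliVec q * pauliVec x).trace = 0 :=
      trace_pauliVec_mul_mul_eq_zero hA.left hA.right a b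
    simp only [dirCorr, mul_add, add_mul, one_mul, mul_one, smul_mul_assoc, mul_smul_comm,
      ← mul_kronecker_mul, trace_smul, trace_add, trace_kronecker, trace_pauliVec,
      trace_pauliVec_mul, hpx, hqx, hry, hsy, h0]
    simp
    ring

/-- For `m = 2` the quantum and maximal correlation sets coincide. -/
theorem stmt5 (A B : Matrix (Fin 2) (Fin 3) ℝ)
    (hA : ∀ i, ∑ k, A i k ^ 2 = 1) (hB : ∀ i, ∑ k, B i k ^ 2 = 1) :
    Cqm A B = Cmax A B := by
  refine (Set.image_mono Sqm_subset_Smax).antisymm ?_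
  rintro _ ⟨ρ, hρ, rfl⟩
  have hA' : A 0 ⬝ᵥ A 0 = 1 := by simpa only [dotProduct, sq] using hA 0
  have hB' : B 0 ⬝ᵥ B 0 = 1 := by simpa only [dotProduct, sq] using hB 0
  obtain ⟨p, q, r, s, hpq, hrs, hps, hqr⟩ := exists_isFrame_dirCorr_eq_zero ρ hA' hB'
  obtain ⟨τ, hτ, hcorr⟩ := exists_mem_Sqm_dirCorr hpq hrs
    (abs_dirCorr_le_one hρ hpq.left hrs.left) (abs_dirCorr_le_one hρ hpq.right hrs.right)
  refine ⟨τ, hτ, ?_⟩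
  ext i j
  obtain ⟨a, b, hab⟩ := hpq.span i
  obtain ⟨c, d, hcd⟩ := hrs.span j
  rw [corr_apply, corr_apply, hab, hcd, hcorr]
  simp only [dirCorr_comb_left, dirCorr_comb_right, hps, hqr]
  ring

end BellCorr
end

section
/- For every real m×m matrix C, the gauge function of the separable correlation set satisfies: if the column space of C is contained in the column space of A and the column space of Cᵀ is contained in the column space of B, then γ_{C_sep}(C) = ‖A⁺ C (Bᵀ)⁺‖_1, the sum of the singular values of the real 3×3 matrix A⁺ C (Bᵀ)⁺; otherwise γ_{C_sep}(C) = +∞. -/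
open Matrix Kronecker
open scoped ENNReal ComplexOrder

namespace BellCorr

/-- The correlation tensor `T k l = Re Tr[ρ (σ_k ⊗ σ_l)]` of a 4×4 matrix, as a real-linear map. -/
noncomputable def corrTensor :
    Matrix (Fin 2 × Fin 2) (Fin 2 × Fin 2) ℂ →ₗ[ℝ] Matrix (Fin 3) (Fin 3) ℝ where
  toFun ρ := Matrix.of fun k l => ((ρ * (pauli k ⊗ₖ pauli l)).trace).re
  map_add' x y := by ext k l; simp [Matrix.add_mul]
  map_smul' c x := by ext k l; simp [Matrix.trace_smul]

lemma corr_eq {m : ℕ} (A B : Matrix (Fin m) (Fin 3) ℝ)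
    (ρ : Matrix (Fin 2 × Fin 2) (Fin 2 × Fin 2) ℂ) :
    corr A B ρ = A * corrTensor ρ * Bᵀ := by
  ext i j
  have h : obs A i ⊗ₖ obs B j =
      ∑ l : Fin 3, ∑ k : Fin 3, ((A i k * B j l : ℝ) : ℂ) • (pauli k ⊗ₖ pauli l) := by
    ext ⟨a, b⟩ ⟨c, d⟩
    simp only [obs, Matrix.kroneckerMap_apply, Matrix.sum_apply, Matrix.smul_apply, smul_eq_mul,
      Finset.sum_mul_sum, Complex.ofReal_mul]
    rw [Finset.sum_comm]
    exact Finset.sum_congr rfl fun l _ => Finset.sum_congr rfl fun k _ => by ring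
  simp only [corr, Matrix.of_apply, h, Matrix.mul_sum, Matrix.trace_sum, Complex.re_sum,
    Matrix.mul_smul, Matrix.trace_smul, smul_eq_mul, Complex.re_ofReal_mul]
  rw [Matrix.mul_apply]
  refine Finset.sum_congr rfl fun l _ => ?_
  rw [Matrix.mul_apply, Finset.sum_mul]
  refine Finset.sum_congr rfl fun k _ => ?_
  simp only [corrTensor, LinearMap.coe_mk, AddHom.coe_mk, Matrix.of_apply, Matrix.transpose_apply]
  ring

/-- The Bloch vector of a 2×2 matrix. -/
noncomputable def bloch (ρ : Matrix (Fin 2) (Fin 2) ℂ) (k : Fin 3) : ℝ :=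
  ((ρ * pauli k).trace).re

lemma trace_mul_pauli_im {ρ : Matrix (Fin 2) (Fin 2) ℂ} (h : ρ.IsHermitian) (k : Fin 3) :
    ((ρ * pauli k).trace).im = 0 := by
  have h00 := congrArg Complex.im (h.apply 0 0)
  have h11 := congrArg Complex.im (h.apply 1 1)
  have h01 := h.apply 0 1
  have h01r := congrArg Complex.re h01
  have h01i := congrArg Complex.im h01
  simp at h00 h11 h01r h01i
  fin_cases k <;> simp [pauli, Matrix.trace_fin_two, Matrix.mul_apply] <;> linarith

lemma corrTensor_kronecker {ρA ρB : Matrix (Fin 2) (Fin 2) ℂ} (hA : ρA.IsHermitian) :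
    corrTensor (ρA ⊗ₖ ρB) = Matrix.vecMulVec (bloch ρA) (bloch ρB) := by
  ext k l
  simp [corrTensor, ← Matrix.mul_kronecker_mul, Matrix.trace_kronecker, Matrix.vecMulVec_apply,
    bloch, trace_mul_pauli_im hA]

lemma bloch_sq_le {ρ : Matrix (Fin 2) (Fin 2) ℂ} (h : ρ.PosSemidef) (ht : ρ.trace = 1) :
    bloch ρ ⬝ᵥ bloch ρ ≤ 1 := by
  have hd := (Complex.le_def.1 h.det_nonneg).1
  have h00 := congrArg Complex.im (h.1.apply 0 0)
  have h11 := congrArg Complex.im (h.1.apply 1 1)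
  have h01r := congrArg Complex.re (h.1.apply 0 1)
  have h01i := congrArg Complex.im (h.1.apply 0 1)
  have htr := congrArg Complex.re ht
  simp [Matrix.trace_fin_two] at h00 h11 h01r h01i htr
  have e00 : (ρ 0 0).im = 0 := by linarith
  have e11 : (ρ 1 1).im = 0 := by linarith
  have e11r : (ρ 1 1).re = 1 - (ρ 0 0).re := by linarith
  have e01 : (ρ 0 1).im = -(ρ 1 0).im := by linarith
  simp [Matrix.det_fin_two, e00, e01, e11r, ← h01r] at hd
  simp [bloch, pauli, Matrix.trace_fin_two, Matrix.mul_apply, dotProduct, Fin.sum_univ_three,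
    e01, e11r, ← h01r]
  nlinarith

/-- The qubit state with a given Bloch vector. -/
noncomputable def blochState (a : Fin 3 → ℝ) : Matrix (Fin 2) (Fin 2) ℂ :=
  !![(((1 + a 2) / 2 : ℝ) : ℂ), ⟨a 0 / 2, -(a 1 / 2)⟩; ⟨a 0 / 2, a 1 / 2⟩, (((1 - a 2) / 2 : ℝ) : ℂ)]

lemma bloch_blochState (a : Fin 3 → ℝ) : bloch (blochState a) = a := by
  ext k
  fin_cases k <;> simp [bloch, blochState, pauli, Matrix.trace_fin_two] <;> ring

lemma trace_blochState (a : Fin 3 → ℝ) : (blochState a).trace = 1 := by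
  simp [blochState, Matrix.trace_fin_two]
  ring

lemma isHermitian_blochState (a : Fin 3 → ℝ) : (blochState a).IsHermitian := by
  ext i j
  fin_cases i <;> fin_cases j <;> simp [blochState, Complex.ext_iff]

lemma posSemidef_blochState {a : Fin 3 → ℝ} (ha : a ⬝ᵥ a = 1) :
    (blochState a).PosSemidef := by
  have h : (blochState a)ᴴ * blochState a = blochState a := by
    rw [(isHermitian_blochState a).eq]
    simp only [dotProduct, Fin.sum_univ_three] at ha
    ext i j
    fin_cases i <;> fin_cases j <;>
      simp [blochState, Complex.ext_iff, Matrix.mul_apply, -Complex.ofReal_add,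
        -Complex.ofReal_sub, -Complex.ofReal_div] <;> (try constructor) <;> nlinarith
  exact h ▸ Matrix.posSemidef_conjTranspose_mul_self _

lemma posSemidef_blochState_zero : (blochState 0).PosSemidef := by
  have h : blochState 0 = (2⁻¹ : ℝ) • (1 : Matrix (Fin 2) (Fin 2) ℂ) := by
    ext i j
    fin_cases i <;> fin_cases j <;> simp [blochState, Complex.ext_iff]
  rw [h]
  exact Matrix.PosSemidef.one.smul (by norm_num)

lemma vecMulVec_mem_corrTensor_image {a b : Fin 3 → ℝ} (ha : a ⬝ᵥ a = 1 ∨ a = 0)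
    (hb : b ⬝ᵥ b = 1 ∨ b = 0) : Matrix.vecMulVec a b ∈ corrTensor '' Ssep := by
  have key : ∀ c : Fin 3 → ℝ, c ⬝ᵥ c = 1 ∨ c = 0 → (blochState c).PosSemidef := by
    rintro c (hc | rfl)
    · exact posSemidef_blochState hc
    · exact posSemidef_blochState_zero
  refine ⟨blochState a ⊗ₖ blochState b, subset_convexHull ℝ _ ⟨_, _, key a ha,
    trace_blochState a, key b hb, trace_blochState b, rfl⟩, ?_⟩
  rw [corrTensor_kronecker (isHermitian_blochState a), bloch_blochState, bloch_blochState]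

lemma convex_corrTensor_image : Convex ℝ (corrTensor '' Ssep) :=
  (convex_convexHull ℝ _).linear_image _

/-- A (partial) singular value decomposition of a real 3×3 matrix: left singular vectors
belonging to the singular value zero are taken to be zero. -/
lemma exists_svd (X : Matrix (Fin 3) (Fin 3) ℝ) :
    ∃ (U V : Matrix (Fin 3) (Fin 3) ℝ) (d e : Fin 3 → ℝ), (∀ k, 0 ≤ d k) ∧
      (∀ k, e k = 0 ∨ e k = 1) ∧ (∀ k, e k * d k = d k) ∧ Uᵀ * U = Matrix.diagonal e ∧
      Vᵀ * V = 1 ∧ X = U * Matrix.diagonal d * Vᵀ ∧ ∑ k, d k = sval X 0 + sval X 1 + sval X 2 := by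
  set hH := isHermitian_tr_mul_self X
  set l := hH.eigenvalues
  set V : Matrix (Fin 3) (Fin 3) ℝ := (hH.eigenvectorUnitary : Matrix (Fin 3) (Fin 3) ℝ)
  have hl0 : ∀ k, 0 ≤ l k := by
    have : (Xᵀ * X).PosSemidef := by
      simpa [Matrix.conjTranspose_eq_transpose_of_trivial] using
        Matrix.posSemidef_conjTranspose_mul_self X
    exact this.eigenvalues_nonneg
  have hVV : Vᵀ * V = 1 := by
    have := Unitary.coe_star_mul_self hH.eigenvectorUnitary
    simpa [Matrix.star_eq_conjTranspose, Matrix.conjTranspose_eq_transpose_of_trivial] using this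
  have hVV' : V * Vᵀ = 1 := mul_eq_one_comm.1 hVV
  have hdiag : (X * V)ᵀ * (X * V) = Matrix.diagonal l := by
    have h : Xᵀ * X = V * Matrix.diagonal l * Vᵀ := by
      have := hH.spectral_theorem
      simpa [Unitary.conjStarAlgAut_apply, Matrix.star_eq_conjTranspose,
        Matrix.conjTranspose_eq_transpose_of_trivial, Function.comp_def] using this
    calc (X * V)ᵀ * (X * V) = Vᵀ * (Xᵀ * X) * V := by
          simp only [Matrix.transpose_mul, Matrix.mul_assoc]
      _ = (Vᵀ * V) * Matrix.diagonal l * (Vᵀ * V) := by rw [h]; simp only [Matrix.mul_assoc]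
      _ = _ := by rw [hVV]; simp
  set s : Fin 3 → ℝ := fun k => Real.sqrt (l k)
  have hss : ∀ k, s k * s k = l k := fun k => Real.mul_self_sqrt (hl0 k)
  refine ⟨X * V * Matrix.diagonal (fun k => (s k)⁻¹), V, s, fun k => (s k)⁻¹ * l k * (s k)⁻¹,
    fun k => Real.sqrt_nonneg _, fun k => ?_, fun k => ?_, ?_, hVV, ?_, ?_⟩
  · rcases eq_or_ne (s k) 0 with h | h
    · simp [h]
    · right
      change (s k)⁻¹ * l k * (s k)⁻¹ = 1
      rw [← hss]
      field_simp
  · rcases eq_or_ne (s k) 0 with h | h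
    · simp [h]
    · change (s k)⁻¹ * l k * (s k)⁻¹ * s k = s k
      rw [← hss]
      field_simp
  · rw [Matrix.transpose_mul, Matrix.diagonal_transpose, Matrix.mul_assoc,
      ← Matrix.mul_assoc (X * V)ᵀ, hdiag, Matrix.diagonal_mul_diagonal,
      Matrix.diagonal_mul_diagonal]
    simp [mul_assoc]
  · have h : X * V * Matrix.diagonal (fun k => (s k)⁻¹) * Matrix.diagonal s = X * V := by
      ext i k
      rw [Matrix.mul_diagonal, Matrix.mul_diagonal]
      rcases eq_or_ne (s k) 0 with h | h
      · have h0 : ∑ j, (X * V) j k * (X * V) j k = 0 := by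
          have := congrFun (congrFun hdiag k) k
          rw [Matrix.mul_apply, Matrix.diagonal_apply_eq, ← hss, h] at this
          simpa using this
        have h1 := (Finset.sum_eq_zero_iff_of_nonneg
          (fun j _ => mul_self_nonneg ((X * V) j k))).1 h0 i (Finset.mem_univ i)
        rw [mul_self_eq_zero.1 h1]; simp
      · field_simp
    rw [h, Matrix.mul_assoc, hVV', Matrix.mul_one]
  · have h : ∑ k, s k = ∑ i : Fin 3, sval X i :=
      (Equiv.sum_comp (Fin.revPerm.trans (Tuple.sort l)) s).symm
    rw [h, Fin.sum_univ_three]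

/-- Bessel's inequality for the columns of a matrix. -/
lemma transpose_mulVec_sq_le {U : Matrix (Fin 3) (Fin 3) ℝ} {e : Fin 3 → ℝ}
    (he : ∀ k, e k ≤ 1) (hU : Uᵀ * U = Matrix.diagonal e) (a : Fin 3 → ℝ) :
    (Uᵀ *ᵥ a) ⬝ᵥ (Uᵀ *ᵥ a) ≤ a ⬝ᵥ a := by
  set c := Uᵀ *ᵥ a
  have h0 : 0 ≤ (a - U *ᵥ c) ⬝ᵥ (a - U *ᵥ c) := by
    simpa using dotProduct_star_self_nonneg (a - U *ᵥ c)
  have h1 : a ⬝ᵥ (U *ᵥ c) = c ⬝ᵥ c := by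
    rw [Matrix.dotProduct_mulVec, ← Matrix.mulVec_transpose]
  have h2 : (U *ᵥ c) ⬝ᵥ (U *ᵥ c) ≤ c ⬝ᵥ c := by
    rw [Matrix.dotProduct_mulVec, ← Matrix.mulVec_transpose, Matrix.mulVec_mulVec, hU]
    simp only [dotProduct, Matrix.mulVec_diagonal]
    exact Finset.sum_le_sum fun k _ => by nlinarith [he k, mul_self_nonneg (c k)]
  rw [sub_dotProduct, dotProduct_sub, dotProduct_sub, dotProduct_comm (U *ᵥ c) a, h1] at h0
  linarith

/-- A symmetric idempotent matrix is a contraction. -/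
lemma mulVec_sq_le_of_projection {P : Matrix (Fin 3) (Fin 3) ℝ} (hs : Pᵀ = P) (hP : P * P = P)
    (a : Fin 3 → ℝ) : (P *ᵥ a) ⬝ᵥ (P *ᵥ a) ≤ a ⬝ᵥ a := by
  have h0 : 0 ≤ (a - P *ᵥ a) ⬝ᵥ (a - P *ᵥ a) := by
    simpa using dotProduct_star_self_nonneg (a - P *ᵥ a)
  have h1 : a ⬝ᵥ (P *ᵥ a) = (P *ᵥ a) ⬝ᵥ (P *ᵥ a) := by
    conv_rhs => rw [Matrix.dotProduct_mulVec, ← Matrix.mulVec_transpose, Matrix.mulVec_mulVec,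
      hs, hP, dotProduct_comm]
  rw [sub_dotProduct, dotProduct_sub, dotProduct_sub, dotProduct_comm (P *ᵥ a) a, h1] at h0
  linarith

/-- The nuclear norm of a compressed correlation tensor of a separable state is at most one. -/
lemma trace_corrTensor_le {U V P Q : Matrix (Fin 3) (Fin 3) ℝ} {e : Fin 3 → ℝ}
    (he : ∀ k, e k ≤ 1) (hU : Uᵀ * U = Matrix.diagonal e) (hV : Vᵀ * V = 1)
    (hPs : Pᵀ = P) (hP : P * P = P) (hQs : Qᵀ = Q) (hQ : Q * Q = Q)
    {ρ : Matrix (Fin 2 × Fin 2) (Fin 2 × Fin 2) ℂ} (hρ : ρ ∈ Ssep) :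
    (Uᵀ * (P * corrTensor ρ * Q) * V).trace ≤ 1 := by
  let f : Matrix (Fin 2 × Fin 2) (Fin 2 × Fin 2) ℂ →ₗ[ℝ] ℝ :=
    { toFun := fun ρ => (Uᵀ * (P * corrTensor ρ * Q) * V).trace
      map_add' := fun x y => by simp [Matrix.mul_add, Matrix.add_mul]
      map_smul' := fun c x => by simp }
  have hsub : Ssep ⊆ {ρ | f ρ ≤ 1} := by
    refine convexHull_min ?_ (convex_halfSpace_le f.isLinear 1)
    rintro _ ⟨ρA, ρB, hA, hAt, hB, hBt, rfl⟩
    change (Uᵀ * (P * corrTensor (ρA ⊗ₖ ρB) * Q) * V).trace ≤ 1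
    rw [corrTensor_kronecker hA.1]
    set a := bloch ρA
    set b := bloch ρB
    have ha : (Uᵀ *ᵥ (P *ᵥ a)) ⬝ᵥ (Uᵀ *ᵥ (P *ᵥ a)) ≤ 1 :=
      (transpose_mulVec_sq_le he hU _).trans
        ((mulVec_sq_le_of_projection hPs hP a).trans (bloch_sq_le hA hAt))
    have hb : (Vᵀ *ᵥ (Q *ᵥ b)) ⬝ᵥ (Vᵀ *ᵥ (Q *ᵥ b)) ≤ 1 :=
      (transpose_mulVec_sq_le (e := fun _ => 1) (fun _ => le_rfl) (by simpa using hV) _).trans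
        ((mulVec_sq_le_of_projection hQs hQ b).trans (bloch_sq_le hB hBt))
    have heq : Uᵀ * (P * Matrix.vecMulVec a b * Q) * V =
        Matrix.vecMulVec (Uᵀ *ᵥ (P *ᵥ a)) (Vᵀ *ᵥ (Q *ᵥ b)) := by
      conv_rhs => rw [← hQs]
      simp only [Matrix.mul_vecMulVec, Matrix.vecMulVec_mul, Matrix.mulVec_transpose]
    rw [heq, Matrix.trace_vecMulVec]
    simp only [dotProduct, Fin.sum_univ_three] at ha hb ⊢
    set x := Uᵀ *ᵥ (P *ᵥ a)
    set y := Vᵀ *ᵥ (Q *ᵥ b)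
    nlinarith [sq_nonneg (x 0 - y 0), sq_nonneg (x 1 - y 1), sq_nonneg (x 2 - y 2)]
  exact hsub hρ

/-- A matrix whose nuclear norm is at most `t` is `t` times a separable correlation tensor. -/
lemma inv_smul_mem_corrTensor_image (X : Matrix (Fin 3) (Fin 3) ℝ) {t : ℝ} (ht : 0 < t)
    (h : sval X 0 + sval X 1 + sval X 2 ≤ t) : t⁻¹ • X ∈ corrTensor '' Ssep := by
  obtain ⟨U, V, d, e, hd, he, hed, hU, hV, hX, hsum⟩ := exists_svd X
  rw [← hsum] at h
  have hmem : ∀ k, Matrix.vecMulVec (U.col k) (V.col k) ∈ corrTensor '' Ssep := by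
    intro k
    have hUk : U.col k ⬝ᵥ U.col k = e k := by
      simpa [Matrix.mul_apply, dotProduct] using congrFun (congrFun hU k) k
    have hVk : V.col k ⬝ᵥ V.col k = 1 := by
      simpa [Matrix.mul_apply, dotProduct] using congrFun (congrFun hV k) k
    refine vecMulVec_mem_corrTensor_image ?_ (Or.inl hVk)
    rcases he k with h0 | h1
    · exact Or.inr (dotProduct_self_eq_zero.1 (hUk.trans h0))
    · exact Or.inl (hUk.trans h1)
  have hzero : (0 : Matrix (Fin 3) (Fin 3) ℝ) ∈ corrTensor '' Ssep := by
    simpa using vecMulVec_mem_corrTensor_image (a := 0) (b := 0) (Or.inr rfl) (Or.inr rfl)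
  have hXsum : X = ∑ k, d k • Matrix.vecMulVec (U.col k) (V.col k) := by
    ext i j
    conv_lhs => rw [hX]
    rw [Matrix.mul_apply, Matrix.sum_apply]
    exact Finset.sum_congr rfl fun k _ => by
      simp [Matrix.mul_diagonal, Matrix.vecMulVec_apply]; ring
  let w : Option (Fin 3) → ℝ := fun o => o.elim (1 - t⁻¹ * ∑ k, d k) fun k => t⁻¹ * d k
  let z : Option (Fin 3) → Matrix (Fin 3) (Fin 3) ℝ :=
    fun o => o.elim 0 fun k => Matrix.vecMulVec (U.col k) (V.col k)
  have hw : t⁻¹ * ∑ k, d k ≤ 1 := by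
    rw [inv_mul_le_iff₀ ht]; simpa using h
  have := convex_corrTensor_image.sum_mem (t := Finset.univ) (w := w) (z := z)
    (by
      rintro (_ | k) -
      · simpa [w] using hw
      · exact mul_nonneg (inv_nonneg.2 ht.le) (hd k))
    (by simp [w, Fintype.sum_option, Finset.mul_sum])
    (by
      rintro (_ | k) -
      · exact hzero
      · exact hmem k)
  rw [Fintype.sum_option] at this
  rw [hXsum, Finset.smul_sum]
  simpa [w, z, mul_smul] using this

lemma mul_mul_eq_of_colSpace_le {m n p : ℕ} {A : Matrix (Fin m) (Fin n) ℝ}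
    {C : Matrix (Fin m) (Fin p) ℝ} {Y : Matrix (Fin n) (Fin m) ℝ} (hY : A * Y * A = A)
    (h : colSpace C ≤ colSpace A) : A * Y * C = C := by
  refine Matrix.ext_of_mulVec_single fun j => ?_
  obtain ⟨x, hx⟩ := h ⟨Pi.single j 1, rfl⟩
  simp only [Matrix.mulVecLin_apply] at hx
  rw [← Matrix.mulVec_mulVec, ← hx, Matrix.mulVec_mulVec, hY]

lemma colSpace_mul_le {m n p : ℕ} (A : Matrix (Fin m) (Fin n) ℝ) (D : Matrix (Fin n) (Fin p) ℝ) :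
    colSpace (A * D) ≤ colSpace A := by
  rw [colSpace, Matrix.mulVecLin_mul]
  exact LinearMap.range_comp_le_range _ _

lemma exists_of_inv_smul_mem_Csep {m : ℕ} {A B : Matrix (Fin m) (Fin 3) ℝ}
    {C : Matrix (Fin m) (Fin m) ℝ} {t : ℝ} (ht : 0 < t) (h : t⁻¹ • C ∈ Csep A B) :
    ∃ ρ ∈ Ssep, C = A * (t • corrTensor ρ) * Bᵀ := by
  obtain ⟨ρ, hρ, h⟩ := h
  refine ⟨ρ, hρ, ?_⟩
  rw [Matrix.mul_smul, Matrix.smul_mul, ← corr_eq, h, smul_inv_smul₀ ht.ne']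

/-- Gauge function of the separable correlation set:
`γ_{C_sep}(C) = ‖A⁺ C (Bᵀ)⁺‖₁` under the range conditions, and `+∞` otherwise. -/
theorem stmt6 {m : ℕ} (hm : 1 ≤ m) (A B : Matrix (Fin m) (Fin 3) ℝ)
    (hA : ∀ i, ∑ k, A i k ^ 2 = 1) (hB : ∀ i, ∑ k, B i k ^ 2 = 1)
    (C : Matrix (Fin m) (Fin m) ℝ)
    (Ap : Matrix (Fin 3) (Fin m) ℝ) (Bp : Matrix (Fin m) (Fin 3) ℝ)
    (hAp : IsMP A Ap) (hBp : IsMP Bᵀ Bp) :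
    (colSpace C ≤ colSpace A ∧ colSpace Cᵀ ≤ colSpace B →
      gaugeFn (Csep A B) C =
        ENNReal.ofReal
          (sval (Ap * C * Bp) 0 + sval (Ap * C * Bp) 1 + sval (Ap * C * Bp) 2)) ∧
    (¬(colSpace C ≤ colSpace A ∧ colSpace Cᵀ ≤ colSpace B) →
      gaugeFn (Csep A B) C = ⊤) := by
  obtain ⟨hA1, hA2, -, hA4⟩ := hAp
  obtain ⟨hB1, hB2, hB3, -⟩ := hBp
  refine ⟨fun ⟨hCA, hCB⟩ => ?_, fun hC => ?_⟩
  · have hfac : A * (Ap * C * Bp) * Bᵀ = C := by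
      have h1 := mul_mul_eq_of_colSpace_le hA1 hCA
      have h2 : B * Bpᵀ * Cᵀ = Cᵀ := by
        refine mul_mul_eq_of_colSpace_le ?_ hCB
        simpa [Matrix.mul_assoc] using congrArg Matrix.transpose hB1
      have h3 : C * Bp * Bᵀ = C := by
        simpa [Matrix.mul_assoc] using congrArg Matrix.transpose h2
      calc A * (Ap * C * Bp) * Bᵀ = (A * Ap * C) * Bp * Bᵀ := by simp only [Matrix.mul_assoc]
        _ = C := by rw [h1, h3]
    apply le_antisymm
    · refine ENNReal.le_of_forall_pos_le_add fun ε hε _ => ?_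
      have hs : 0 ≤ sval (Ap * C * Bp) 0 + sval (Ap * C * Bp) 1 + sval (Ap * C * Bp) 2 :=
        add_nonneg (add_nonneg (Real.sqrt_nonneg _) (Real.sqrt_nonneg _)) (Real.sqrt_nonneg _)
      have hε' : (0 : ℝ) < ε := hε
      have ht := add_pos_of_nonneg_of_pos hs hε'
      rw [← ENNReal.ofReal_coe_nnreal, ← ENNReal.ofReal_add hs hε'.le]
      refine iInf₂_le _ ⟨ht, ?_⟩
      obtain ⟨ρ, hρ, h⟩ := inv_smul_mem_corrTensor_image (Ap * C * Bp) ht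
        (le_add_of_nonneg_right hε'.le)
      refine ⟨ρ, hρ, ?_⟩
      rw [corr_eq, h, Matrix.mul_smul, Matrix.smul_mul, hfac]
    · refine le_iInf₂ fun t ht => ENNReal.ofReal_le_ofReal ?_
      obtain ⟨ρ, hρ, h⟩ := exists_of_inv_smul_mem_Csep ht.1 ht.2
      obtain ⟨U, V, d, e, -, he, hed, hU, hV, hX, hsum⟩ := exists_svd (Ap * C * Bp)
      rw [← hsum]
      have htr : (Uᵀ * (Ap * C * Bp) * V).trace = ∑ k, d k := by
        have : Uᵀ * (Ap * C * Bp) * V = Uᵀ * U * Matrix.diagonal d * (Vᵀ * V) := by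
          rw [hX]; simp only [Matrix.mul_assoc]
        rw [this, hU, hV, Matrix.mul_one, Matrix.diagonal_mul_diagonal, Matrix.trace_diagonal]
        exact Finset.sum_congr rfl fun k _ => hed k
      have hXt : Ap * C * Bp = t • ((Ap * A) * corrTensor ρ * (Bᵀ * Bp)) := by
        rw [h]; simp only [Matrix.mul_assoc, Matrix.mul_smul, Matrix.smul_mul]
      have hle := trace_corrTensor_le (P := Ap * A) (Q := Bᵀ * Bp)
        (fun k => by rcases he k with h | h <;> simp [h]) hU hV
        hA4 (by rw [← Matrix.mul_assoc, hA2]) hB3 (by rw [← Matrix.mul_assoc, hB1]) hρ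
      rw [← htr, hXt, Matrix.mul_smul, Matrix.smul_mul, Matrix.trace_smul, smul_eq_mul]
      exact mul_le_of_le_one_right ht.1.le hle
  · refine iInf₂_eq_top.2 fun t ht => absurd ?_ hC
    obtain ⟨ρ, -, h⟩ := exists_of_inv_smul_mem_Csep ht.1 ht.2
    refine ⟨?_, ?_⟩
    · rw [h, Matrix.mul_assoc]
      exact colSpace_mul_le _ _
    · rw [h, Matrix.transpose_mul, Matrix.transpose_transpose]
      exact colSpace_mul_le _ _

end BellCorr
end
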